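/- arXiv:2212.06381 — 13 statements merged into one kernel-verified Lean document; each statement's English description precedes it below -/
import Mathlib

section
/- Suppose Γ := Γ11 + 2·Γ12 + Γ22 > 0, let M1, M2 > 0, and set m⁻ := 32·π³·σ01² / ((1+√2)²·Γ²·(M1+M2)²). If (m^k)_{k∈ℕ} is a minimizing configuration for the masses (M1, M2) which has at least two nonzero components (i.e., there exist indices k ≠ l with m^k ≠ (0,0) and m^l ≠ (0,0)), then every nonzero component satisfies m1^k + m2^k ≥ m⁻. -/
open scoped ENNReal

/-- The droplet energy of a single component `m = (m₁, m₂)`. -/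
noncomputable def e0 (σ01 σ12 Γ11 Γ12 Γ22 : ℝ) (m : ℝ × ℝ) : ℝ :=
  2 * σ01 * Real.sqrt (Real.pi * (m.1 + m.2)) + 2 * σ12 * Real.sqrt (Real.pi * m.2)
    + (1 / (4 * Real.pi)) * (Γ11 * m.1 ^ 2 + 2 * Γ12 * m.1 * m.2 + Γ22 * m.2 ^ 2)

/-- A configuration for masses `(M1, M2)`: a sequence of pairs of nonnegative reals
whose first (resp. second) coordinates sum to `M1` (resp. `M2`). -/
def IsConfig (M1 M2 : ℝ) (m : ℕ → ℝ × ℝ) : Prop :=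
  (∀ k, 0 ≤ (m k).1 ∧ 0 ≤ (m k).2) ∧ (∑' k, (m k).1) = M1 ∧ (∑' k, (m k).2) = M2

/-- Total energy of a configuration, valued in `ℝ≥0∞` (the summands are nonnegative). -/
noncomputable def energy (σ01 σ12 Γ11 Γ12 Γ22 : ℝ) (m : ℕ → ℝ × ℝ) : ℝ≥0∞ :=
  ∑' k, ENNReal.ofReal (e0 σ01 σ12 Γ11 Γ12 Γ22 (m k))

/-- A minimizing configuration for masses `(M1, M2)`. -/
def IsMinimizing (σ01 σ12 Γ11 Γ12 Γ22 M1 M2 : ℝ) (m : ℕ → ℝ × ℝ) : Prop :=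
  IsConfig M1 M2 m ∧ ∀ n : ℕ → ℝ × ℝ, IsConfig M1 M2 n →
    energy σ01 σ12 Γ11 Γ12 Γ22 m ≤ energy σ01 σ12 Γ11 Γ12 Γ22 n

lemma aux_sqrt (x y s r : ℝ) (hx : 0 ≤ x) (hxy : x ≤ y) (hr : 0 ≤ r)
    (hr2 : r ^ 2 = 2) (h : s ^ 2 = x ^ 2 + y ^ 2) : r * x ≤ (1 + r) * (x + y - s) := by
  have : (1 + r) * s ≤ x + (1 + r) * y := by
    apply abs_le_of_sq_le_sq' _ _ |>.2
    · have h1 : 0 ≤ (1 + r) * x * (y - x) := by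
        have : 0 ≤ y - x := by linarith
        positivity
      have e : (x + (1 + r) * y) ^ 2 - ((1 + r) * s) ^ 2 = 2 * ((1 + r) * x * (y - x)) := by
        linear_combination (-(1 + r) ^ 2) * h - x ^ 2 * hr2
      linarith
    · have : 0 ≤ y := hx.trans hxy
      positivity
  linarith

lemma aux_key (σ G A B M : ℝ) (hσ : 0 < σ) (hG : 0 < G) (hA : 0 < A) (hAB : A ≤ B) (hBM : B ≤ M)
    (h : 2 * σ * √(Real.pi * A) + 2 * σ * √(Real.pi * B) ≤
      2 * σ * √(Real.pi * (A + B)) + 1 / (4 * Real.pi) * (2 * G * A * B)) :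
    32 * Real.pi ^ 3 * σ ^ 2 / ((1 + √2) ^ 2 * G ^ 2 * M ^ 2) ≤ A := by
  have hpi := Real.pi_pos
  have hB : 0 < B := hA.trans_le hAB
  have hM : 0 < M := hB.trans_le hBM
  rw [Real.sqrt_mul hpi.le, Real.sqrt_mul hpi.le, Real.sqrt_mul hpi.le] at h
  have hr2 : √2 ^ 2 = (2:ℝ) := Real.sq_sqrt (by norm_num)
  have hp2 : √Real.pi ^ 2 = Real.pi := Real.sq_sqrt hpi.le
  have hA2 : √A ^ 2 = A := Real.sq_sqrt hA.le
  have hB2 : √B ^ 2 = B := Real.sq_sqrt hB.le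
  have hS2 : √(A + B) ^ 2 = A + B := Real.sq_sqrt (by linarith)
  have h1 := aux_sqrt (√A) (√B) (√(A + B)) (√2) (by positivity) (Real.sqrt_le_sqrt hAB)
    (by positivity) hr2 (by rw [hA2, hB2, hS2])
  have hx : 0 < √A := Real.sqrt_pos.2 hA
  have hp : 0 < √Real.pi := Real.sqrt_pos.2 hpi
  have hr : 0 < √(2:ℝ) := by positivity
  generalize √A = x at *
  generalize √B = y at *
  generalize √(A + B) = s at *
  generalize √(2:ℝ) = r at *
  generalize √Real.pi = p at *
  generalize Real.pi = q at *
  subst hp2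
  have h2 : 4 * σ * p ^ 3 * (x + y - s) ≤ G * A * B := by
    have e : 1 / (4 * p ^ 2) * (2 * G * A * B) = G * A * B / (2 * p ^ 2) := by
      field_simp; ring
    rw [e] at h
    have h' : 2 * σ * p * (x + y - s) ≤ G * A * B / (2 * p ^ 2) := by linarith
    rw [le_div_iff₀ (by positivity)] at h'
    linarith
  have h3 : 4 * σ * p ^ 3 * (r * x) ≤ (1 + r) * (G * A * B) := by
    calc 4 * σ * p ^ 3 * (r * x) ≤ 4 * σ * p ^ 3 * ((1 + r) * (x + y - s)) := by gcongr
      _ = (1 + r) * (4 * σ * p ^ 3 * (x + y - s)) := by ring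
      _ ≤ _ := by gcongr
  have h4 : 4 * σ * p ^ 3 * r ≤ (1 + r) * G * M * x := by
    have : (4 * σ * p ^ 3 * r) * x ≤ ((1 + r) * G * M * x) * x := by
      calc _ = 4 * σ * p ^ 3 * (r * x) := by ring
        _ ≤ (1 + r) * (G * A * B) := h3
        _ ≤ (1 + r) * (G * A * M) := by gcongr
        _ = _ := by rw [← hA2]; ring
    exact le_of_mul_le_mul_right this hx
  rw [div_le_iff₀ (by positivity)]
  have h5 : (4 * σ * p ^ 3 * r) ^ 2 ≤ ((1 + r) * G * M * x) ^ 2 := by gcongr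
  calc _ = (4 * σ * p ^ 3 * r) ^ 2 := by rw [mul_pow _ r, hr2]; ring
    _ ≤ _ := h5
    _ = _ := by rw [← hA2]; ring

lemma e0_nonneg' (σ01 σ12 Γ11 Γ12 Γ22 : ℝ)
    (hσ01 : 0 < σ01) (hσ12 : 0 < σ12)
    (hΓ11 : 0 ≤ Γ11) (hΓ12 : 0 ≤ Γ12) (hΓ22 : 0 ≤ Γ22) (p : ℝ × ℝ) (h1 : 0 ≤ p.1)
    (h2 : 0 ≤ p.2) : 0 ≤ e0 σ01 σ12 Γ11 Γ12 Γ22 p := by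
  have hpi := Real.pi_pos
  unfold e0
  positivity

lemma aux_merge (σ01 σ12 Γ11 Γ12 Γ22 M1 M2 : ℝ)
    (hσ01 : 0 < σ01) (hσ12 : 0 < σ12)
    (hΓ11 : 0 ≤ Γ11) (hΓ12 : 0 ≤ Γ12) (hΓ22 : 0 ≤ Γ22)
    (hM1 : 0 < M1) (hM2 : 0 < M2)
    (m : ℕ → ℝ × ℝ) (hmin : IsMinimizing σ01 σ12 Γ11 Γ12 Γ22 M1 M2 m)
    (k l : ℕ) (hkl : k ≠ l) :
    e0 σ01 σ12 Γ11 Γ12 Γ22 (m k) + e0 σ01 σ12 Γ11 Γ12 Γ22 (m l) ≤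
      e0 σ01 σ12 Γ11 Γ12 Γ22 (m k + m l) := by
  obtain ⟨⟨hnn, hs1, hs2⟩, hle⟩ := hmin
  set e := e0 σ01 σ12 Γ11 Γ12 Γ22 with he
  have he0 : e (0, 0) = 0 := by simp [he, e0]
  have hen : ∀ p : ℝ × ℝ, 0 ≤ p.1 → 0 ≤ p.2 → 0 ≤ e p :=
    e0_nonneg' _ _ _ _ _ hσ01 hσ12 hΓ11 hΓ12 hΓ22
  have H1 : HasSum (fun i => (m i).1) M1 := by
    have : Summable (fun i => (m i).1) := by
      by_contra h
      rw [tsum_eq_zero_of_not_summable h] at hs1; linarith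
    exact hs1 ▸ this.hasSum
  have H2 : HasSum (fun i => (m i).2) M2 := by
    have : Summable (fun i => (m i).2) := by
      by_contra h
      rw [tsum_eq_zero_of_not_summable h] at hs2; linarith
    exact hs2 ▸ this.hasSum
  -- the energy is finite
  have hfin : ∑' i, ENNReal.ofReal (e (m i)) ≠ ⊤ := by
    let n : ℕ → ℝ × ℝ := fun i => if i = 0 then (M1, M2) else (0, 0)
    have hn : IsConfig M1 M2 n := by
      refine ⟨fun i => ?_, ?_, ?_⟩
      · by_cases hi : i = 0 <;> simp [n, hi, hM1.le, hM2.le]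
      · rw [tsum_eq_single 0]
        · simp [n]
        · intro i hi; simp [n, hi]
      · rw [tsum_eq_single 0]
        · simp [n]
        · intro i hi; simp [n, hi]
    refine ne_top_of_le_ne_top ?_ (hle n hn)
    unfold energy
    rw [tsum_eq_single 0]
    · exact ENNReal.ofReal_ne_top
    · intro i hi
      simp only [n, hi, if_false]
      rw [← he, he0]; simp
  have hsum : Summable (fun i => e (m i)) := by
    have := ENNReal.summable_toReal hfin
    refine this.congr fun i => ?_
    rw [ENNReal.toReal_ofReal (hen _ (hnn i).1 (hnn i).2)]
  let n : ℕ → ℝ × ℝ := Function.update (Function.update m k (m k + m l)) l (0, 0)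
  have hcomp : ∀ f : ℝ × ℝ → ℝ, (fun i => f (n i)) =
      Function.update (Function.update (fun i => f (m i)) k (f (m k + m l))) l (f (0, 0)) := by
    intro f
    funext i
    by_cases hi : i = l
    · subst hi; simp [n]
    · by_cases hi' : i = k
      · subst hi'; simp [n, hi]
      · simp [n, hi, hi']
  have hS : ∀ (f : ℝ × ℝ → ℝ) (a : ℝ), HasSum (fun i => f (m i)) a →
      HasSum (fun i => f (n i)) (f (0, 0) - f (m l) + (f (m k + m l) - f (m k) + a)) := by
    intro f a h
    rw [hcomp f]
    have := (h.update k (f (m k + m l))).update l (f (0, 0))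
    rwa [Function.update_of_ne hkl.symm] at this
  have hnn' : ∀ i, 0 ≤ (n i).1 ∧ 0 ≤ (n i).2 := by
    intro i
    by_cases hi : i = l
    · subst hi; simp [n]
    · by_cases hi' : i = k
      · subst hi'
        simp only [n, Function.update_of_ne hi, Function.update_self]
        exact ⟨add_nonneg (hnn _).1 (hnn _).1, add_nonneg (hnn _).2 (hnn _).2⟩
      · simpa [n, hi, hi'] using hnn i
  have hn : IsConfig M1 M2 n := by
    refine ⟨hnn', ?_, ?_⟩
    · rw [(hS Prod.fst M1 H1).tsum_eq]; simp
    · rw [(hS Prod.snd M2 H2).tsum_eq]; simp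
  have hE := hle n hn
  have hSe := hS e _ hsum.hasSum
  unfold energy at hE
  rw [← he, ← ENNReal.ofReal_tsum_of_nonneg (fun i => hen _ (hnn i).1 (hnn i).2) hsum,
    ← ENNReal.ofReal_tsum_of_nonneg (fun i => hen _ (hnn' i).1 (hnn' i).2) hSe.summable,
    ENNReal.ofReal_le_ofReal_iff (tsum_nonneg fun i => hen _ (hnn' i).1 (hnn' i).2),
    hSe.tsum_eq, he0] at hE
  linarith

lemma aux_ineq (σ01 σ12 Γ11 Γ12 Γ22 : ℝ) (hσ12 : 0 < σ12)
    (hΓ11 : 0 ≤ Γ11) (hΓ12 : 0 ≤ Γ12) (hΓ22 : 0 ≤ Γ22) (a b : ℝ × ℝ)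
    (ha1 : 0 ≤ a.1) (ha2 : 0 ≤ a.2) (hb1 : 0 ≤ b.1) (hb2 : 0 ≤ b.2)
    (h : e0 σ01 σ12 Γ11 Γ12 Γ22 a + e0 σ01 σ12 Γ11 Γ12 Γ22 b ≤ e0 σ01 σ12 Γ11 Γ12 Γ22 (a + b)) :
    2 * σ01 * √(Real.pi * (a.1 + a.2)) + 2 * σ01 * √(Real.pi * (b.1 + b.2)) ≤
      2 * σ01 * √(Real.pi * ((a.1 + a.2) + (b.1 + b.2))) + 1 / (4 * Real.pi) *
        (2 * (Γ11 + 2 * Γ12 + Γ22) * (a.1 + a.2) * (b.1 + b.2)) := by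
  obtain ⟨a1, a2⟩ := a
  obtain ⟨b1, b2⟩ := b
  simp only [e0, Prod.mk_add_mk] at *
  have hpi := Real.pi_pos
  have hs : √(Real.pi * (a2 + b2)) ≤ √(Real.pi * a2) + √(Real.pi * b2) := by
    rw [mul_add]
    refine Real.sqrt_le_iff.2 ⟨by positivity, ?_⟩
    rw [add_sq, Real.sq_sqrt (by positivity), Real.sq_sqrt (by positivity)]
    have : 0 ≤ 2 * √(Real.pi * a2) * √(Real.pi * b2) := by positivity
    linarith
  have hs' := mul_le_mul_of_nonneg_left hs (by positivity : 0 ≤ 2 * σ12)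
  have hc : 0 ≤ 1 / (4 * Real.pi) := by positivity
  have hq : 0 ≤ 1 / (4 * Real.pi) * (2 * (Γ11 * (a1 * b2 + a2 * b1 + a2 * b2)
      + Γ12 * (2 * a1 * b1 + a1 * b2 + a2 * b1 + 2 * a2 * b2)
      + Γ22 * (a1 * b1 + a1 * b2 + a2 * b1))) := by positivity
  rw [show (a1 + b1 + (a2 + b2)) = a1 + a2 + (b1 + b2) by ring] at h
  linarith

/-- in a minimizing configuration with at least two nonzero components,
every nonzero component has total mass at least
`m⁻ = 32π³σ01² / ((1+√2)²Γ²(M1+M2)²)` where `Γ = Γ11 + 2Γ12 + Γ22`. -/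
theorem mass_lower_bound_of_minimizing (σ01 σ12 Γ11 Γ12 Γ22 M1 M2 : ℝ)
    (hσ01 : 0 < σ01) (hσ12 : 0 < σ12)
    (hΓ11 : 0 ≤ Γ11) (hΓ12 : 0 ≤ Γ12) (hΓ22 : 0 ≤ Γ22)
    (hΓ : 0 < Γ11 + 2 * Γ12 + Γ22)
    (hM1 : 0 < M1) (hM2 : 0 < M2)
    (m : ℕ → ℝ × ℝ) (hmin : IsMinimizing σ01 σ12 Γ11 Γ12 Γ22 M1 M2 m)
    (htwo : ∃ k l : ℕ, k ≠ l ∧ m k ≠ (0, 0) ∧ m l ≠ (0, 0)) :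
    ∀ k : ℕ, m k ≠ (0, 0) →
      32 * Real.pi ^ 3 * σ01 ^ 2 /
          ((1 + Real.sqrt 2) ^ 2 * (Γ11 + 2 * Γ12 + Γ22) ^ 2 * (M1 + M2) ^ 2)
        ≤ (m k).1 + (m k).2 := by
  have hc := hmin.1
  obtain ⟨hnn, hs1, hs2⟩ := hc
  intro k hk
  obtain ⟨l, hkl, hl⟩ : ∃ l, k ≠ l ∧ m l ≠ (0, 0) := by
    obtain ⟨i, j, hij, hi, hj⟩ := htwo
    by_cases h : k = i
    · exact ⟨j, h ▸ hij, hj⟩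
    · exact ⟨i, h, hi⟩
  have hpos : ∀ i, m i ≠ (0, 0) → 0 < (m i).1 + (m i).2 := by
    intro i hi
    obtain ⟨h1, h2⟩ := hnn i
    rcases (add_nonneg h1 h2).lt_or_eq with h | h
    · exact h
    · exact absurd (Prod.ext (by simp; linarith) (by simp; linarith)) hi
  have hub : ∀ i, (m i).1 + (m i).2 ≤ M1 + M2 := by
    intro i
    have S1 : Summable (fun i => (m i).1) := by
      by_contra h
      rw [tsum_eq_zero_of_not_summable h] at hs1; linarith
    have S2 : Summable (fun i => (m i).2) := by
      by_contra h
      rw [tsum_eq_zero_of_not_summable h] at hs2; linarith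
    have := S1.le_tsum i (fun j _ => (hnn j).1)
    have := S2.le_tsum i (fun j _ => (hnn j).2)
    linarith
  have h := aux_ineq σ01 σ12 Γ11 Γ12 Γ22 hσ12 hΓ11 hΓ12 hΓ22 (m k) (m l)
    (hnn k).1 (hnn k).2 (hnn l).1 (hnn l).2
    (aux_merge σ01 σ12 Γ11 Γ12 Γ22 M1 M2 hσ01 hσ12 hΓ11 hΓ12 hΓ22 hM1 hM2 m hmin k l hkl)
  rcases le_total ((m k).1 + (m k).2) ((m l).1 + (m l).2) with hle | hle
  · exact aux_key _ _ _ _ _ hσ01 hΓ (hpos k hk) hle (hub l) h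
  · refine (aux_key σ01 (Γ11 + 2 * Γ12 + Γ22) _ _ _ hσ01 hΓ (hpos l hl) hle (hub k) ?_).trans hle
    rw [add_comm ((m l).1 + (m l).2)]
    linarith
end

section
/- Suppose Γ := Γ11 + 2·Γ12 + Γ22 > 0 and M1, M2 > 0. If (m^k)_{k∈ℕ} is a minimizing configuration for the masses (M1, M2), then the set {k : m^k ≠ (0,0)} is finite; moreover, if this set has at least two elements, then its cardinality is at most (M1+M2)/m⁻ = (1+√2)²·Γ²·(M1+M2)³/(32·π³·σ01²), where m⁻ := 32·π³·σ01² / ((1+√2)²·Γ²·(M1+M2)²). -/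
open scoped ENNReal

theorem e0_nonneg_aux (σ01 σ12 Γ11 Γ12 Γ22 : ℝ)
    (hσ01 : 0 < σ01) (hσ12 : 0 < σ12)
    (hΓ11 : 0 ≤ Γ11) (hΓ12 : 0 ≤ Γ12) (hΓ22 : 0 ≤ Γ22) (p : ℝ × ℝ) (h : 0 ≤ p.1 ∧ 0 ≤ p.2) :
    0 ≤ e0 σ01 σ12 Γ11 Γ12 Γ22 p := by
  obtain ⟨h1, h2⟩ := h
  unfold e0
  positivity

theorem e0_zero_aux (σ01 σ12 Γ11 Γ12 Γ22 : ℝ) : e0 σ01 σ12 Γ11 Γ12 Γ22 (0, 0) = 0 := by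
  simp [e0]

theorem tsum_two_aux (g : ℕ → ℝ≥0∞) (k l : ℕ) (hkl : k ≠ l) :
    ∑' i, g i = g k + (g l + ∑' i, if i = l then 0 else if i = k then 0 else g i) := by
  rw [ENNReal.summable.tsum_eq_add_tsum_ite' k, ENNReal.summable.tsum_eq_add_tsum_ite' l]
  simp [hkl.symm]

theorem merge_aux (σ01 σ12 Γ11 Γ12 Γ22 M1 M2 : ℝ)
    (hσ01 : 0 < σ01) (hσ12 : 0 < σ12)
    (hΓ11 : 0 ≤ Γ11) (hΓ12 : 0 ≤ Γ12) (hΓ22 : 0 ≤ Γ22)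
    (m : ℕ → ℝ × ℝ) (hmin : IsMinimizing σ01 σ12 Γ11 Γ12 Γ22 M1 M2 m)
    (hM1 : 0 < M1) (hM2 : 0 < M2)
    (hs1 : Summable fun k => (m k).1) (hs2 : Summable fun k => (m k).2)
    (k l : ℕ) (hkl : k ≠ l) :
    e0 σ01 σ12 Γ11 Γ12 Γ22 (m k) + e0 σ01 σ12 Γ11 Γ12 Γ22 (m l) ≤
      e0 σ01 σ12 Γ11 Γ12 Γ22 (m k + m l) := by
  obtain ⟨⟨hn, h1, h2⟩, hle⟩ := hmin
  have nn := e0_nonneg_aux σ01 σ12 Γ11 Γ12 Γ22 hσ01 hσ12 hΓ11 hΓ12 hΓ22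
  have hfin : energy σ01 σ12 Γ11 Γ12 Γ22 m ≠ ⊤ := by
    refine ne_top_of_le_ne_top ?_ (hle (fun i => if i = 0 then (M1, M2) else (0, 0)) ⟨?_, ?_, ?_⟩)
    · unfold energy
      rw [tsum_eq_single 0]
      · exact ENNReal.ofReal_ne_top
      · intro b hb
        simp [hb, e0_zero_aux]
    · intro i
      by_cases hi : i = 0 <;> simp [hi, hM1.le, hM2.le]
    · rw [tsum_eq_single 0]
      · simp
      · intro b hb
        simp [hb]
    · rw [tsum_eq_single 0]
      · simp
      · intro b hb
        simp [hb]
  set n : ℕ → ℝ × ℝ := Function.update (Function.update m k (m k + m l)) l (0, 0) with hndef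
  have hnk : n k = m k + m l := by simp [hndef, Function.update_of_ne hkl]
  have hnl : n l = (0, 0) := by simp [hndef]
  have hno : ∀ i, i ≠ k → i ≠ l → n i = m i := by
    intro i h1 h2
    simp [hndef, Function.update_of_ne h1, Function.update_of_ne h2]
  have hsum : ∀ π : ℝ × ℝ → ℝ, (∀ x y, π (x + y) = π x + π y) → π (0,0) = 0 → 
      Summable (fun i => π (m i)) → ∑' i, π (n i) = ∑' i, π (m i) := by
    intro π ha h0 hs
    have e := ((hs.hasSum.update k (π (m k + m l))).update l (π (0,0))).tsum_eq
    rw [Function.update_of_ne hkl.symm, h0, ha] at e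
    have : (fun i => π (n i)) = Function.update (Function.update (fun i => π (m i)) k (π (m k) + π (m l))) l 0 := by
      funext i
      by_cases hi : i = l
      · subst hi; simp [hnl, h0]
      · by_cases hi' : i = k
        · subst hi'; simp [hnk, hi, ha]
        · simp [hi, hi', hno]
    rw [this, e]; ring
  have hcfg : IsConfig M1 M2 n := by
    refine ⟨?_, ?_, ?_⟩
    · intro i
      by_cases hi : i = l
      · subst hi; simp [hnl]
      · by_cases hi' : i = k
        · subst hi'; rw [hnk]
          exact ⟨add_nonneg (hn i).1 (hn l).1, add_nonneg (hn i).2 (hn l).2⟩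
        · rw [hno i hi' hi]; exact hn i
    · rw [hsum Prod.fst (fun _ _ => rfl) rfl hs1, h1]
    · rw [hsum Prod.snd (fun _ _ => rfl) rfl hs2, h2]
  have key := hle n hcfg
  unfold energy at key hfin
  rw [tsum_two_aux _ k l hkl] at hfin
  rw [tsum_two_aux _ k l hkl, tsum_two_aux (fun i => ENNReal.ofReal (e0 σ01 σ12 Γ11 Γ12 Γ22 (n i))) k l hkl] at key
  have hR : (∑' i, if i = l then 0 else if i = k then 0 else ENNReal.ofReal (e0 σ01 σ12 Γ11 Γ12 Γ22 (n i)))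
      = ∑' i, if i = l then 0 else if i = k then 0 else ENNReal.ofReal (e0 σ01 σ12 Γ11 Γ12 Γ22 (m i)) := by
    congr 1
    funext i
    by_cases hi : i = l
    · simp [hi]
    · by_cases hi' : i = k
      · simp [hi']
      · simp [hi, hi', hno]
  rw [hR] at key
  have hRt : (∑' i, if i = l then 0 else if i = k then 0 else ENNReal.ofReal (e0 σ01 σ12 Γ11 Γ12 Γ22 (m i))) ≠ ⊤ := by
    intro h
    rw [h] at hfin
    simp at hfin
  rw [hnk, hnl, e0_zero_aux, ENNReal.ofReal_zero, zero_add, ← add_assoc,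
    ENNReal.add_le_add_iff_right hRt, ← ENNReal.ofReal_add (nn _ (hn k)) (nn _ (hn l))] at key
  exact (ENNReal.ofReal_le_ofReal_iff (nn _ ⟨add_nonneg (hn k).1 (hn l).1, add_nonneg (hn k).2 (hn l).2⟩)).1 key

theorem sqrt_sub_aux (x y s : ℝ) (hx : 0 ≤ x) (hy : 0 ≤ y) (hs : 0 ≤ s)
    (h : s ^ 2 = x ^ 2 + y ^ 2) : 2 * (x * y) ≤ (x + y - s) * ((1 + √2) * s) := by
  have h2 : √2 ^ 2 = 2 := Real.sq_sqrt (by norm_num)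
  have h3 : x + y ≤ √2 * s := by
    apply abs_le_of_sq_le_sq' _ (by positivity) |>.2
    nlinarith [sq_nonneg (x - y)]
  have h4 : s ≤ x + y := by
    apply abs_le_of_sq_le_sq' _ (by positivity) |>.2
    nlinarith [mul_nonneg hx hy]
  nlinarith [mul_nonneg (sub_nonneg.2 h4) (sub_nonneg.2 h3)]

theorem lower_aux (σ01 σ12 Γ11 Γ12 Γ22 : ℝ)
    (hσ01 : 0 < σ01) (hσ12 : 0 < σ12)
    (hΓ11 : 0 ≤ Γ11) (hΓ12 : 0 ≤ Γ12) (hΓ22 : 0 ≤ Γ22)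
    (a b : ℝ × ℝ) (ha : 0 ≤ a.1 ∧ 0 ≤ a.2) (hb : 0 ≤ b.1 ∧ 0 ≤ b.2)
    (hA : 0 < a.1 + a.2) (hB : 0 < b.1 + b.2) 
    (h : e0 σ01 σ12 Γ11 Γ12 Γ22 a + e0 σ01 σ12 Γ11 Γ12 Γ22 b ≤ e0 σ01 σ12 Γ11 Γ12 Γ22 (a + b)) :
    64 * Real.pi ^ 3 * σ01 ^ 2 ≤ (1 + √2) ^ 2 * (Γ11 + 2 * Γ12 + Γ22) ^ 2 *
      ((a.1 + a.2) * (b.1 + b.2) * (a.1 + a.2 + (b.1 + b.2))) := by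
  obtain ⟨a1, a2⟩ := a
  obtain ⟨b1, b2⟩ := b
  simp only [e0, Prod.mk_add_mk] at *
  obtain ⟨ha1, ha2⟩ := ha
  obtain ⟨hb1, hb2⟩ := hb
  have hpi := Real.pi_pos
  have hsub : √(Real.pi * (a2 + b2)) ≤ √(Real.pi * a2) + √(Real.pi * b2) := by
    rw [mul_add]
    exact Real.sqrt_le_iff.2 ⟨by positivity, by nlinarith [Real.sq_sqrt (mul_nonneg hpi.le ha2), Real.sq_sqrt (mul_nonneg hpi.le hb2), mul_nonneg (Real.sqrt_nonneg (Real.pi * a2)) (Real.sqrt_nonneg (Real.pi * b2))]⟩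
  have hsub' := mul_le_mul_of_nonneg_left hsub (by positivity : 0 ≤ 2 * σ12)
  rw [show a1 + b1 + (a2 + b2) = (a1 + a2) + (b1 + b2) by ring] at h
  have hq : Γ11 * (a1 * b1) + Γ12 * (a1 * b2 + a2 * b1) + Γ22 * (a2 * b2) ≤
      (Γ11 + 2 * Γ12 + Γ22) * ((a1 + a2) * (b1 + b2)) := by
    have e1 := mul_nonneg ha1 hb1
    have e2 := mul_nonneg ha1 hb2
    have e3 := mul_nonneg ha2 hb1
    have e4 := mul_nonneg ha2 hb2
    nlinarith [mul_nonneg hΓ11 e1, mul_nonneg hΓ11 e2, mul_nonneg hΓ11 e3, mul_nonneg hΓ11 e4,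
      mul_nonneg hΓ12 e1, mul_nonneg hΓ12 e2, mul_nonneg hΓ12 e3, mul_nonneg hΓ12 e4,
      mul_nonneg hΓ22 e1, mul_nonneg hΓ22 e2, mul_nonneg hΓ22 e3, mul_nonneg hΓ22 e4]
  have hq' := mul_le_mul_of_nonneg_left hq (by positivity : 0 ≤ 1 / (2 * Real.pi))
  have hG : 0 ≤ Γ11 + 2 * Γ12 + Γ22 := by positivity
  generalize Γ11 + 2 * Γ12 + Γ22 = G at *
  generalize a1 + a2 = A at *
  generalize b1 + b2 = B at *
  have h5 : 2 * σ01 * (√(Real.pi * A) + √(Real.pi * B) - √(Real.pi * (A + B))) ≤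
      1 / (2 * Real.pi) * (G * (A * B)) := by
    refine le_trans ?_ hq'
    have : (1 : ℝ) / (4 * Real.pi) = 1 / (2 * Real.pi) / 2 := by field_simp; norm_num
    rw [this] at h
    linarith
  have hx := Real.sqrt_pos.2 (mul_pos hpi hA)
  have hy := Real.sqrt_pos.2 (mul_pos hpi hB)
  have hs := Real.sqrt_pos.2 (mul_pos hpi (add_pos hA hB))
  have qx := Real.sq_sqrt (mul_pos hpi hA).le
  have qy := Real.sq_sqrt (mul_pos hpi hB).le
  have qs := Real.sq_sqrt (mul_pos hpi (add_pos hA hB)).le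
  generalize √(Real.pi * A) = x at *
  generalize √(Real.pi * B) = y at *
  generalize √(Real.pi * (A + B)) = s at *
  have h6 := sqrt_sub_aux x y s hx.le hy.le hs.le (by linarith)
  have hr : 0 ≤ √2 := Real.sqrt_nonneg _
  generalize √2 = r at *
  have h7 : 2 * σ01 * (2 * (x * y)) ≤ 1 / (2 * Real.pi) * (G * (A * B)) * ((1 + r) * s) := by
    calc _ ≤ 2 * σ01 * ((x + y - s) * ((1 + r) * s)) := by gcongr
      _ = 2 * σ01 * (x + y - s) * ((1 + r) * s) := by ring
      _ ≤ _ := by gcongr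
  have h8 : 8 * Real.pi ^ 3 * σ01 * (x * y) ≤ G * (x * y) ^ 2 * ((1 + r) * s) := by
    rw [mul_pow, qx, qy]
    have := mul_le_mul_of_nonneg_left h7 (by positivity : 0 ≤ 2 * Real.pi ^ 3)
    calc _ = 2 * Real.pi ^ 3 * (2 * σ01 * (2 * (x * y))) := by ring
      _ ≤ _ := this
      _ = _ := by field_simp
  have h9 : 8 * Real.pi ^ 3 * σ01 ≤ G * (x * y) * ((1 + r) * s) := by
    refine le_of_mul_le_mul_right ?_ (mul_pos hx hy)
    linarith
  have h10 := pow_le_pow_left₀ (by positivity) h9 2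
  have h11 : (G * (x * y) * ((1 + r) * s)) ^ 2 = Real.pi ^ 3 * ((1 + r) ^ 2 * G ^ 2 * (A * B * (A + B))) := by
    rw [show (G * (x * y) * ((1 + r) * s)) ^ 2 = G ^ 2 * (x ^ 2 * y ^ 2) * ((1 + r) ^ 2 * s ^ 2) by ring, qx, qy, qs]
    ring
  rw [h11] at h10
  refine le_of_mul_le_mul_left ?_ (by positivity : 0 < Real.pi ^ 3)
  linarith

/-- a minimizing configuration has finitely many nonzero components,
and if there are at least two of them, their number is at most
`(M1+M2)/m⁻ = (1+√2)²Γ²(M1+M2)³/(32π³σ01²)`. -/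
theorem finiteness_of_minimizing (σ01 σ12 Γ11 Γ12 Γ22 M1 M2 : ℝ)
    (hσ01 : 0 < σ01) (hσ12 : 0 < σ12)
    (hΓ11 : 0 ≤ Γ11) (hΓ12 : 0 ≤ Γ12) (hΓ22 : 0 ≤ Γ22)
    (hΓ : 0 < Γ11 + 2 * Γ12 + Γ22)
    (hM1 : 0 < M1) (hM2 : 0 < M2)
    (m : ℕ → ℝ × ℝ) (hmin : IsMinimizing σ01 σ12 Γ11 Γ12 Γ22 M1 M2 m) :
    {k : ℕ | m k ≠ (0, 0)}.Finite ∧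
      ((∃ k l : ℕ, k ≠ l ∧ m k ≠ (0, 0) ∧ m l ≠ (0, 0)) →
        ({k : ℕ | m k ≠ (0, 0)}.ncard : ℝ) ≤
          (1 + Real.sqrt 2) ^ 2 * (Γ11 + 2 * Γ12 + Γ22) ^ 2 * (M1 + M2) ^ 3 /
            (32 * Real.pi ^ 3 * σ01 ^ 2)) := by


  have hs1 : Summable fun k => (m k).1 := by
    by_contra hc
    have := hmin.1.2.1
    rw [tsum_eq_zero_of_not_summable hc] at this
    linarith
  have hs2 : Summable fun k => (m k).2 := by
    by_contra hc
    have := hmin.1.2.2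
    rw [tsum_eq_zero_of_not_summable hc] at this
    linarith
  have hn := hmin.1.1
  have hs : Summable fun k => (m k).1 + (m k).2 := hs1.add hs2
  have ht : ∑' k, ((m k).1 + (m k).2) = M1 + M2 := by
    rw [hs1.tsum_add hs2, hmin.1.2.1, hmin.1.2.2]
  have hnn : ∀ i, 0 ≤ (m i).1 + (m i).2 := fun i => add_nonneg (hn i).1 (hn i).2
  have hpos : ∀ i, m i ≠ (0, 0) → 0 < (m i).1 + (m i).2 := by
    intro i hi
    refine lt_of_le_of_ne (hnn i) fun h => hi ?_
    have := hn i
    ext <;> simp <;> linarith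
  have hpi := Real.pi_pos
  set C := (1 + √2) ^ 2 * (Γ11 + 2 * Γ12 + Γ22) ^ 2 with hC
  have hCpos : 0 < C := by positivity
  have hlow : ∀ k l, k ≠ l → m k ≠ (0, 0) → m l ≠ (0, 0) →
      32 * Real.pi ^ 3 * σ01 ^ 2 ≤ C * (M1 + M2) ^ 2 * ((m k).1 + (m k).2) := by
    intro k l hkl hk hl
    have h := lower_aux σ01 σ12 Γ11 Γ12 Γ22 hσ01 hσ12 hΓ11 hΓ12 hΓ22 _ _ (hn k) (hn l)
      (hpos k hk) (hpos l hl)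
      (merge_aux σ01 σ12 Γ11 Γ12 Γ22 M1 M2 hσ01 hσ12 hΓ11 hΓ12 hΓ22 m hmin hM1 hM2 hs1 hs2 k l hkl)
    have hle : (m k).1 + (m k).2 + ((m l).1 + (m l).2) ≤ M1 + M2 := by
      have := hs.sum_le_tsum {k, l} (fun i _ => hnn i)
      rwa [Finset.sum_pair hkl, ht] at this
    have hk' := hpos k hk
    have hl' := hpos l hl
    rw [← hC] at h
    generalize (m k).1 + (m k).2 = A at *
    generalize (m l).1 + (m l).2 = B at *
    have : A * B * (A + B) ≤ A * (M1 + M2) * (M1 + M2) := by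
      gcongr
      linarith
    have h' := mul_le_mul_of_nonneg_left this hCpos.le
    have : 0 < Real.pi ^ 3 * σ01 ^ 2 := by positivity
    nlinarith
  have hD : 0 < 32 * Real.pi ^ 3 * σ01 ^ 2 := by positivity
  have hall : (∃ k l : ℕ, k ≠ l ∧ m k ≠ (0, 0) ∧ m l ≠ (0, 0)) → ∀ i, m i ≠ (0, 0) →
      32 * Real.pi ^ 3 * σ01 ^ 2 ≤ C * (M1 + M2) ^ 2 * ((m i).1 + (m i).2) := by
    rintro ⟨k, l, hkl, hk, hl⟩ i hi
    by_cases h : i = k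
    · subst h; exact hlow i l hkl hi hl
    · exact hlow i k h hi hk
  have hfin : {k : ℕ | m k ≠ (0, 0)}.Finite := by
    by_cases hex : ∃ k l : ℕ, k ≠ l ∧ m k ≠ (0, 0) ∧ m l ≠ (0, 0)
    · have h0 := (hs.mul_left (C * (M1 + M2) ^ 2)).tendsto_cofinite_zero.eventually_lt_const hD
      refine Set.Finite.subset (Filter.eventually_cofinite.1 h0) ?_
      intro i hi
      exact not_lt.2 (hall hex i hi)
    · refine Set.Subsingleton.finite ?_
      intro k hk l hl
      by_contra hne
      exact hex ⟨k, l, hne, hk, hl⟩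
  refine ⟨hfin, fun hex => ?_⟩
  rw [le_div_iff₀ hD, Set.ncard_eq_toFinset_card _ hfin]
  calc _ = ∑ i ∈ hfin.toFinset, 32 * Real.pi ^ 3 * σ01 ^ 2 := by simp
    _ ≤ ∑ i ∈ hfin.toFinset, C * (M1 + M2) ^ 2 * ((m i).1 + (m i).2) := by
      refine Finset.sum_le_sum fun i hi => hall hex i ?_
      simpa using hi
    _ = C * (M1 + M2) ^ 2 * ∑ i ∈ hfin.toFinset, ((m i).1 + (m i).2) := by
      rw [Finset.mul_sum]
    _ ≤ C * (M1 + M2) ^ 2 * (M1 + M2) := by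
      gcongr
      rw [← ht]
      exact hs.sum_le_tsum _ (fun i _ => hnn i)
    _ = _ := by ring
end

section
/- Let M1, M2 > 0, set D := Γ11·(M1+M2) + Γ12·M1 + Γ22·M2, and suppose D > 0. If (m^j)_{j∈ℕ} is a minimizing configuration for the masses (M1, M2) and k ≠ l are indices such that 0 < m2^l ≤ m2^k and m2^l ≤ m1^k, then m2^l ≥ 32·π³·σ12² / ((1+√2)²·D²). -/
open scoped ENNReal

lemma e0_nn {σ01 σ12 Γ11 Γ12 Γ22 : ℝ}
    (hσ01 : 0 < σ01) (hσ12 : 0 < σ12)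
    (hΓ11 : 0 ≤ Γ11) (hΓ12 : 0 ≤ Γ12) (hΓ22 : 0 ≤ Γ22) (x : ℝ × ℝ) (h1 : 0 ≤ x.1)
    (h2 : 0 ≤ x.2) : 0 ≤ e0 σ01 σ12 Γ11 Γ12 Γ22 x := by
  unfold e0
  positivity

lemma split_two (f : ℕ → ℝ≥0∞) (k l : ℕ) (hkl : k ≠ l) :
    ∑' i, f i = f k + f l + ∑' i, (if i = l then 0 else if i = k then 0 else f i) := by
  have h1 := ENNReal.tsum_eq_add_tsum_ite (f := f) k
  have h2 := ENNReal.tsum_eq_add_tsum_ite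
    (f := fun i => if i = k then 0 else f i) l
  rw [if_neg hkl.symm] at h2
  rw [h1, add_assoc]
  congr 1
  convert h2

lemma upd_sum (f : ℕ → ℝ) (M : ℝ) (hM : 0 < M) (hf : ∑' i, f i = M) (k l : ℕ) (hkl : k ≠ l)
    (x y : ℝ) (hxy : x + y = f k + f l) :
    ∑' i, (if i = k then x else if i = l then y else f i) = M := by
  have hs : Summable f := by
    by_contra h
    rw [tsum_eq_zero_of_not_summable h] at hf
    linarith
  have h1 : HasSum f M := hf ▸ hs.hasSum
  have h2 := (h1.update l y).update k x
  have e : (fun i => if i = k then x else if i = l then y else f i)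
      = Function.update (Function.update f l y) k x := by
    ext i
    simp [Function.update_apply]
  rw [e, h2.tsum_eq, Function.update_of_ne hkl]
  linarith

lemma sum_le (f : ℕ → ℝ) (M : ℝ) (hM : 0 < M) (hf : ∑' i, f i = M) (h0 : ∀ i, 0 ≤ f i)
    (k : ℕ) : f k ≤ M := by
  have hs : Summable f := by
    by_contra h
    rw [tsum_eq_zero_of_not_summable h] at hf
    linarith
  rw [← hf]
  exact hs.le_tsum k (fun i _ => h0 i)

lemma final_alg {σ01 σ12 Γ11 Γ12 Γ22 M1 M2 a b c t : ℝ} (hσ12 : 0 < σ12)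
    (hΓ11 : 0 ≤ Γ11) (hΓ12 : 0 ≤ Γ12) (hΓ22 : 0 ≤ Γ22)
    (hD : 0 < Γ11 * (M1 + M2) + Γ12 * M1 + Γ22 * M2)
    (ht0 : 0 < t) (htb : t ≤ b) (hta : t ≤ a) (hc0 : 0 ≤ c)
    (ha : a ≤ M1) (hc : c ≤ M1) (hb : b ≤ M2) (ht : t ≤ M2)
    (key : e0 σ01 σ12 Γ11 Γ12 Γ22 (a, b) + e0 σ01 σ12 Γ11 Γ12 Γ22 (c, t) ≤
      e0 σ01 σ12 Γ11 Γ12 Γ22 (a - t, b + t) + e0 σ01 σ12 Γ11 Γ12 Γ22 (c + t, 0)) :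
    32 * Real.pi ^ 3 * σ12 ^ 2 /
        ((1 + Real.sqrt 2) ^ 2 * (Γ11 * (M1 + M2) + Γ12 * M1 + Γ22 * M2) ^ 2) ≤ t := by
  have hpi := Real.pi_pos
  unfold e0 at key
  simp only at key
  rw [show a - t + (b + t) = a + b by ring, show c + t + 0 = c + t by ring, mul_zero,
    Real.sqrt_zero, Real.sqrt_mul hpi.le b, Real.sqrt_mul hpi.le t,
    Real.sqrt_mul hpi.le (b + t)] at key
  have hX : Γ11 * (t - a + c) + Γ12 * (a - b - t - c) + Γ22 * b ≤
      Γ11 * (M1 + M2) + Γ12 * M1 + Γ22 * M2 := by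
    exact add_le_add (add_le_add (mul_le_mul_of_nonneg_left (by linarith) hΓ11)
      (mul_le_mul_of_nonneg_left (by linarith) hΓ12)) (mul_le_mul_of_nonneg_left hb hΓ22)
  set D := Γ11 * (M1 + M2) + Γ12 * M1 + Γ22 * M2
  have hp2 := Real.sq_sqrt hpi.le
  have hp0 := Real.sqrt_pos.2 hpi
  set p := Real.sqrt Real.pi
  have hr2 := Real.sq_sqrt (show (0:ℝ) ≤ 2 by norm_num)
  have hr0 := Real.sqrt_nonneg 2
  set r := Real.sqrt 2
  have hr1 : 1 ≤ r := by nlinarith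
  have hr3 : r ≤ 2 := by nlinarith
  have hs2 := Real.sq_sqrt ht0.le
  have hs0 := Real.sqrt_pos.2 ht0
  have hu2 := Real.sq_sqrt (ht0.le.trans htb)
  have hsu := Real.sqrt_le_sqrt htb
  have hv : Real.sqrt (b + t) ≤ Real.sqrt b + (r - 1) * Real.sqrt t := by
    have h0 : 0 ≤ (r - 1) * Real.sqrt t := mul_nonneg (by linarith) hs0.le
    apply Real.sqrt_le_iff.2 ⟨by linarith, ?_⟩
    have h1 : 0 ≤ ((r - 1) * Real.sqrt t) * (Real.sqrt b - Real.sqrt t) :=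
      mul_nonneg h0 (by linarith)
    have : (Real.sqrt b + (r - 1) * Real.sqrt t) ^ 2 = Real.sqrt b ^ 2 + Real.sqrt t ^ 2
      + 2 * (((r - 1) * Real.sqrt t) * (Real.sqrt b - Real.sqrt t))
      + (r ^ 2 - 2) * Real.sqrt t ^ 2 := by ring
    rw [this, hr2, hu2, hs2]
    linarith
  set s := Real.sqrt t
  set u := Real.sqrt b
  set v := Real.sqrt (b + t)
  have k1 : 2 * σ12 * p * (u + s - v) ≤
      (1 / (4 * Real.pi)) * (2 * t * (Γ11 * (t - a + c) + Γ12 * (a - b - t - c) + Γ22 * b)) := by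
    linear_combination key
  have k2 : 2 * σ12 * p * ((2 - r) * s) ≤ (1 / (4 * Real.pi)) * (2 * t * D) := by
    refine le_trans ?_ (k1.trans ?_)
    · gcongr
      linarith
    · gcongr
  have k3 : 4 * Real.pi * σ12 * p * (2 - r) ≤ s * D := by
    rw [← hs2, div_mul_eq_mul_div, one_mul, le_div_iff₀ (by positivity)] at k2
    refine le_of_mul_le_mul_left ?_ (show 0 < 2 * s by linarith)
    linarith
  have k4 : (4 * Real.pi * σ12 * p * (2 - r)) ^ 2 ≤ (s * D) ^ 2 :=
    pow_le_pow_left₀ (mul_nonneg (by positivity) (by linarith)) k3 2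
  have k5 : 16 * Real.pi ^ 3 * σ12 ^ 2 * (2 - r) ^ 2 ≤ t * D ^ 2 := by
    rw [mul_pow s D, hs2] at k4
    refine le_trans (le_of_eq ?_) k4
    rw [mul_pow, mul_pow _ p, hp2]
    ring
  rw [div_le_iff₀ (by positivity)]
  have k6 : (2 - r) * (1 + r) = r := by linear_combination -hr2
  have k7 := mul_le_mul_of_nonneg_right k5 (sq_nonneg (1 + r))
  have k8 : (2 - r) ^ 2 * (1 + r) ^ 2 = 2 := by rw [← mul_pow, k6, hr2]
  calc 32 * Real.pi ^ 3 * σ12 ^ 2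
      = 16 * Real.pi ^ 3 * σ12 ^ 2 * ((2 - r) ^ 2 * (1 + r) ^ 2) := by rw [k8]; ring
    _ ≤ _ := by linarith

/-- lower bound on the mass of the smaller inner lobe of two core shells
in a minimizing configuration, with `D = Γ11(M1+M2) + Γ12 M1 + Γ22 M2`. -/
theorem inner_lobe_lower_bound (σ01 σ12 Γ11 Γ12 Γ22 M1 M2 : ℝ)
    (hσ01 : 0 < σ01) (hσ12 : 0 < σ12)
    (hΓ11 : 0 ≤ Γ11) (hΓ12 : 0 ≤ Γ12) (hΓ22 : 0 ≤ Γ22)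
    (hM1 : 0 < M1) (hM2 : 0 < M2)
    (hD : 0 < Γ11 * (M1 + M2) + Γ12 * M1 + Γ22 * M2)
    (m : ℕ → ℝ × ℝ) (hmin : IsMinimizing σ01 σ12 Γ11 Γ12 Γ22 M1 M2 m)
    (k l : ℕ) (hkl : k ≠ l)
    (hpos : 0 < (m l).2) (hle2 : (m l).2 ≤ (m k).2) (hle1 : (m l).2 ≤ (m k).1) :
    32 * Real.pi ^ 3 * σ12 ^ 2 /
        ((1 + Real.sqrt 2) ^ 2 * (Γ11 * (M1 + M2) + Γ12 * M1 + Γ22 * M2) ^ 2)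
      ≤ (m l).2 := by
  obtain ⟨⟨hnn, hS1, hS2⟩, hopt⟩ := hmin
  have hc := sum_le _ M1 hM1 hS1 (fun i => (hnn i).1) l
  have hb := sum_le _ M2 hM2 hS2 (fun i => (hnn i).2) k
  have ht := sum_le _ M2 hM2 hS2 (fun i => (hnn i).2) l
  have ha' := sum_le _ M1 hM1 hS1 (fun i => (hnn i).1) k
  -- finite energy
  have hfin : energy σ01 σ12 Γ11 Γ12 Γ22 m ≠ ⊤ := by
    refine ne_top_of_le_ne_top ?_ (hopt (fun i => if i = 0 then (M1, M2) else 0) ⟨?_, ?_, ?_⟩)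
    · unfold energy
      rw [tsum_eq_single 0]
      · exact ENNReal.ofReal_ne_top
      · intro i hi
        simp [hi, e0]
    · intro i
      by_cases hi : i = 0 <;> simp [hi, hM1.le, hM2.le]
    · rw [tsum_eq_single 0]
      · simp
      · intro i hi
        simp [hi]
    · rw [tsum_eq_single 0]
      · simp
      · intro i hi
        simp [hi]
  have key : e0 σ01 σ12 Γ11 Γ12 Γ22 (m k) + e0 σ01 σ12 Γ11 Γ12 Γ22 (m l) ≤
      e0 σ01 σ12 Γ11 Γ12 Γ22 ((m k).1 - (m l).2, (m k).2 + (m l).2)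
      + e0 σ01 σ12 Γ11 Γ12 Γ22 ((m l).1 + (m l).2, 0) := by
    have hk1 := e0_nn hσ01 hσ12 hΓ11 hΓ12 hΓ22 (m k) (hnn k).1 (hnn k).2
    have hl1 := e0_nn hσ01 hσ12 hΓ11 hΓ12 hΓ22 (m l) (hnn l).1 (hnn l).2
    have hk2 := e0_nn hσ01 hσ12 hΓ11 hΓ12 hΓ22
      ((m k).1 - (m l).2, (m k).2 + (m l).2) (by simpa using hle1)
      (add_nonneg (hnn k).2 (hnn l).2)
    have hl2 := e0_nn hσ01 hσ12 hΓ11 hΓ12 hΓ22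
      ((m l).1 + (m l).2, 0) (add_nonneg (hnn l).1 (hnn l).2) le_rfl
    have h := hopt (fun i => if i = k then ((m k).1 - (m l).2, (m k).2 + (m l).2)
      else if i = l then ((m l).1 + (m l).2, 0) else m i) ⟨?_, ?_, ?_⟩
    · unfold energy at h hfin
      rw [split_two _ k l hkl] at h hfin
      rw [split_two (fun i => ENNReal.ofReal (e0 σ01 σ12 Γ11 Γ12 Γ22 (if i = k then _
        else if i = l then _ else m i))) k l hkl] at h
      have hR := (ENNReal.add_ne_top.1 hfin).2
      have e : (fun i => if i = l then 0 else if i = k then 0 else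
          ENNReal.ofReal (e0 σ01 σ12 Γ11 Γ12 Γ22
          (if i = k then ((m k).1 - (m l).2, (m k).2 + (m l).2)
            else if i = l then ((m l).1 + (m l).2, 0) else m i)))
          = fun i => if i = l then 0 else if i = k then 0 else
            ENNReal.ofReal (e0 σ01 σ12 Γ11 Γ12 Γ22 (m i)) := by
        ext i
        by_cases h1 : i = l <;> by_cases h2 : i = k <;> simp [h1, h2]
      rw [e, ENNReal.add_le_add_iff_right hR] at h
      simp only [if_true, if_neg hkl.symm] at h
      rw [← ENNReal.ofReal_add hk1 hl1, ← ENNReal.ofReal_add hk2 hl2,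
        ENNReal.ofReal_le_ofReal_iff (add_nonneg hk2 hl2)] at h
      exact h
    · intro i
      dsimp only
      split_ifs
      · exact ⟨by simpa using hle1, add_nonneg (hnn k).2 (hnn l).2⟩
      · exact ⟨add_nonneg (hnn l).1 (hnn l).2, le_rfl⟩
      · exact hnn i
    · rw [← upd_sum _ M1 hM1 hS1 k l hkl ((m k).1 - (m l).2) ((m l).1 + (m l).2) (by ring)]
      congr 1
      ext i
      dsimp only
      split_ifs <;> rfl
    · rw [← upd_sum _ M2 hM2 hS2 k l hkl ((m k).2 + (m l).2) 0 (by ring)]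
      congr 1
      ext i
      dsimp only
      split_ifs <;> rfl
  exact final_alg hσ12 hΓ11 hΓ12 hΓ22 hD hpos hle2 hle1 (hnn l).1 ha' hc hb ht key
end

section
/- Suppose Γ11 > 0 and M1, M2 > 0. If a minimizing configuration (m^j)_{j∈ℕ} for the masses (M1, M2) contains two distinct components k ≠ l with m^k = m^l = (m, 0) for some m > 0 (two type-1 single bubbles of equal mass), then m^{3/2} ≥ 4·(2−√2)·π^{3/2}·σ01 / Γ11. -/
open scoped ENNReal

/-- if a minimizing configuration contains two distinct type-1
single bubbles of equal mass `m > 0`, then `m^(3/2) ≥ 4(2−√2)π^(3/2)σ01/Γ11`. -/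
theorem equal_single_bubbles_lower_bound (σ01 σ12 Γ11 Γ12 Γ22 M1 M2 : ℝ)
    (hσ01 : 0 < σ01) (hσ12 : 0 < σ12)
    (hΓ11 : 0 < Γ11) (hΓ12 : 0 ≤ Γ12) (hΓ22 : 0 ≤ Γ22)
    (hM1 : 0 < M1) (hM2 : 0 < M2)
    (mseq : ℕ → ℝ × ℝ) (hmin : IsMinimizing σ01 σ12 Γ11 Γ12 Γ22 M1 M2 mseq)
    (k l : ℕ) (hkl : k ≠ l) (m : ℝ) (hm : 0 < m)
    (hk : mseq k = (m, 0)) (hl : mseq l = (m, 0)) :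
    4 * (2 - Real.sqrt 2) * Real.pi ^ ((3 : ℝ) / 2) * σ01 / Γ11 ≤ m ^ ((3 : ℝ) / 2) := by
  classical
  obtain ⟨⟨hnn, h1, h2⟩, hle⟩ := hmin
  have hs1 : HasSum (fun j => (mseq j).1) M1 := by
    have : Summable (fun j => (mseq j).1) := by
      by_contra h
      rw [tsum_eq_zero_of_not_summable h] at h1
      linarith
    rw [← h1]; exact this.hasSum
  have hpi := Real.pi_pos
  -- finiteness of the energy
  have hfin : energy σ01 σ12 Γ11 Γ12 Γ22 mseq ≠ ⊤ := by
    have hc : IsConfig M1 M2 (fun j => if j = 0 then (M1, M2) else (0, 0)) := by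
      refine ⟨fun j => ?_, ?_, ?_⟩
      · by_cases h : j = 0 <;> simp [h, hM1.le, hM2.le]
      · rw [tsum_eq_single 0]
        · simp
        · intro b hb; simp [hb]
      · rw [tsum_eq_single 0]
        · simp
        · intro b hb; simp [hb]
    refine ne_top_of_le_ne_top ?_ (hle _ hc)
    unfold energy
    rw [tsum_eq_single 0]
    · exact ENNReal.ofReal_ne_top
    · intro b hb; simp [hb, e0]
  -- the merged configuration
  let n : ℕ → ℝ × ℝ := fun j => if j = k then (2 * m, 0) else if j = l then (0, 0) else mseq j
  have hlk : l ≠ k := hkl.symm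
  have hn : IsConfig M1 M2 n := by
    refine ⟨fun j => ?_, ?_, ?_⟩
    · by_cases h : j = k
      · simp [n, h, hm.le]
      · by_cases h' : j = l
        · simp [n, h', hlk]
        · simpa [n, h, h'] using hnn j
    · have ha := (hs1.add (hasSum_ite_eq k m)).sub (hasSum_ite_eq l m)
      have : M1 + m - m = M1 := by ring
      rw [this] at ha
      rw [← ha.tsum_eq]
      congr 1
      funext j
      by_cases h : j = k
      · subst h; simp [n, hkl, hk]; ring
      · by_cases h' : j = l
        · subst h'; simp [n, hlk, hl]
        · simp [n, h, h']
    · rw [← h2]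
      congr 1
      funext j
      by_cases h : j = k
      · subst h; simp [n, hk]
      · by_cases h' : j = l
        · subst h'; simp [n, hlk, hl]
        · simp [n, h, h']
  have hE := hle n hn
  set E1 := ENNReal.ofReal (e0 σ01 σ12 Γ11 Γ12 Γ22 (m, 0)) with hE1
  set E2 := ENNReal.ofReal (e0 σ01 σ12 Γ11 Γ12 Γ22 (2 * m, 0)) with hE2
  have hz : e0 σ01 σ12 Γ11 Γ12 Γ22 (0, 0) = 0 := by simp [e0]
  have key : energy σ01 σ12 Γ11 Γ12 Γ22 mseq + E2
      = energy σ01 σ12 Γ11 Γ12 Γ22 n + (E1 + E1) := by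
    unfold energy
    have e2 := tsum_ite_eq k (fun _ : ℕ => E2)
    have e1 := tsum_ite_eq k (fun _ : ℕ => E1)
    have e1' := tsum_ite_eq l (fun _ : ℕ => E1)
    rw [← e2]
    nth_rewrite 1 [← e1]
    rw [← e1', ← ENNReal.tsum_add, ← ENNReal.tsum_add, ← ENNReal.tsum_add]
    congr 1
    funext j
    by_cases h : j = k
    · subst h; simp [n, hkl, hk, hE1, hE2, add_comm]
    · by_cases h' : j = l
      · subst h'; simp [n, hlk, hl, hE1, hz]
      · simp [n, h, h']
  have h3 : E1 + E1 ≤ E2 := by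
    have : energy σ01 σ12 Γ11 Γ12 Γ22 mseq + (E1 + E1)
        ≤ energy σ01 σ12 Γ11 Γ12 Γ22 mseq + E2 := by
      rw [key]; gcongr
    exact (ENNReal.add_le_add_iff_left hfin).1 this
  have p1 : 0 ≤ e0 σ01 σ12 Γ11 Γ12 Γ22 (m, 0) := by unfold e0; simp; positivity
  have p2 : 0 ≤ e0 σ01 σ12 Γ11 Γ12 Γ22 (2 * m, 0) := by unfold e0; simp; positivity
  rw [hE1, hE2, ← ENNReal.ofReal_add p1 p1, ENNReal.ofReal_le_ofReal_iff p2] at h3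
  have r32 : ∀ x : ℝ, 0 < x → x ^ ((3 : ℝ) / 2) = x * √x := by
    intro x hx
    rw [show (3 : ℝ) / 2 = 1 + 1 / 2 by norm_num, Real.rpow_add hx, Real.rpow_one,
      Real.sqrt_eq_rpow]
  rw [r32 _ hpi, r32 _ hm, div_le_iff₀ hΓ11]
  have q : √(Real.pi * (2 * m)) = √2 * (√Real.pi * √m) := by
    rw [show Real.pi * (2 * m) = 2 * (Real.pi * m) by ring, Real.sqrt_mul (by norm_num),
      Real.sqrt_mul hpi.le]
  simp only [e0, add_zero, q, Real.sqrt_mul hpi.le, mul_zero, Real.sqrt_zero] at h3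
  have hsm : 0 < √m := Real.sqrt_pos.2 hm
  have hmm : √m * √m = m := Real.mul_self_sqrt hm.le
  have h4 : 2 * σ01 * (2 - √2) * (√Real.pi * √m) ≤ Γ11 * m ^ 2 / (2 * Real.pi) := by
    have e : Γ11 * m ^ 2 / (2 * Real.pi)
      = 1 / (4 * Real.pi) * (Γ11 * (2 * m) ^ 2) - 2 * (1 / (4 * Real.pi) * (Γ11 * m ^ 2)) := by
      field_simp; ring
    rw [e]
    nlinarith [h3]
  rw [le_div_iff₀ (by positivity)] at h4
  refine le_of_mul_le_mul_right ?_ hsm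
  calc _ = 2 * σ01 * (2 - √2) * (√Real.pi * √m) * (2 * Real.pi) := by ring
    _ ≤ Γ11 * m ^ 2 := h4
    _ = m * (√m * √m) * Γ11 := by rw [hmm]; ring
    _ = _ := by ring
end

section
/- Suppose Γ12 = 0 and M1, M2 > 0. Then no minimizing configuration (m^j)_{j∈ℕ} for the masses (M1, M2) can contain two different types of single bubbles: there are no indices k ≠ l with m^k = (a, 0) for some a > 0 and m^l = (0, b) for some b > 0. -/
open scoped ENNReal

theorem merge_lt (σ01 σ12 Γ11 Γ22 a b : ℝ) (hσ01 : 0 < σ01) (ha : 0 < a) (hb : 0 < b) :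
    e0 σ01 σ12 Γ11 0 Γ22 (a, b) < e0 σ01 σ12 Γ11 0 Γ22 (a, 0) + e0 σ01 σ12 Γ11 0 Γ22 (0, b) := by
  have hpi := Real.pi_pos
  have h : Real.sqrt (Real.pi * (a + b)) < Real.sqrt (Real.pi * a) + Real.sqrt (Real.pi * b) := by
    have h1 : 0 < Real.sqrt (Real.pi * a) := Real.sqrt_pos.2 (by positivity)
    have h2 : 0 < Real.sqrt (Real.pi * b) := Real.sqrt_pos.2 (by positivity)
    rw [Real.sqrt_lt' (by positivity)]
    have h3 := Real.sq_sqrt (show 0 ≤ Real.pi * a by positivity)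
    have h4 := Real.sq_sqrt (show 0 ≤ Real.pi * b by positivity)
    nlinarith [mul_pos h1 h2]
  have h' := mul_lt_mul_of_pos_left h (show 0 < 2 * σ01 by positivity)
  simp only [e0, add_zero, zero_add, mul_zero, Real.sqrt_zero]
  ring_nf at h' ⊢
  linarith

/-- when `Γ12 = 0`, no minimizing configuration contains two
single bubbles of different types. -/
theorem no_two_types_of_single_bubbles (σ01 σ12 Γ11 Γ12 Γ22 M1 M2 : ℝ)
    (hσ01 : 0 < σ01) (hσ12 : 0 < σ12)
    (hΓ11 : 0 ≤ Γ11) (hΓ12 : Γ12 = 0) (hΓ22 : 0 ≤ Γ22)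
    (hM1 : 0 < M1) (hM2 : 0 < M2)
    (m : ℕ → ℝ × ℝ) (hmin : IsMinimizing σ01 σ12 Γ11 Γ12 Γ22 M1 M2 m) :
    ¬ ∃ k l : ℕ, k ≠ l ∧ (∃ a : ℝ, 0 < a ∧ m k = (a, 0)) ∧
      (∃ b : ℝ, 0 < b ∧ m l = (0, b)) := by
  rintro ⟨k, l, hkl, ⟨a, ha, hk⟩, ⟨b, hb, hl⟩⟩
  subst hΓ12
  obtain ⟨⟨hpos, hs1, hs2⟩, hle⟩ := hmin
  have hfin : energy σ01 σ12 Γ11 0 Γ22 m ≠ ⊤ := by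
    refine ne_top_of_le_ne_top ?_
      (hle (fun j => if j = 0 then (M1, M2) else (0, 0)) ⟨?_, ?_, ?_⟩)
    · unfold energy
      rw [tsum_eq_single 0]
      · exact ENNReal.ofReal_ne_top
      · intro j hj
        simp [hj, e0]
    · intro j
      by_cases hj : j = 0 <;> simp [hj, hM1.le, hM2.le]
    · rw [tsum_eq_single 0]
      · simp
      · intro j hj
        simp [hj]
    · rw [tsum_eq_single 0]
      · simp
      · intro j hj
        simp [hj]
  have hdec := merge_lt σ01 σ12 Γ11 Γ22 a b hσ01 ha hb
  have hA : 0 ≤ e0 σ01 σ12 Γ11 0 Γ22 (a, 0) := by unfold e0; simp only; positivity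
  have hB : 0 ≤ e0 σ01 σ12 Γ11 0 Γ22 (0, b) := by unfold e0; simp only; positivity
  have hC : ENNReal.ofReal (e0 σ01 σ12 Γ11 0 Γ22 (a, b)) <
      ENNReal.ofReal (e0 σ01 σ12 Γ11 0 Γ22 (a, 0))
        + ENNReal.ofReal (e0 σ01 σ12 Γ11 0 Γ22 (0, b)) := by
    rw [← ENNReal.ofReal_add hA hB]
    apply (ENNReal.ofReal_lt_ofReal_iff_of_nonneg _).2 hdec
    unfold e0; simp only; positivity
  let n : ℕ → ℝ × ℝ := fun j => if j = k then (a, b) else if j = l then (0, 0) else m j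
  have hn : IsConfig M1 M2 n := by
    refine ⟨?_, ?_, ?_⟩
    · intro j
      by_cases h1 : j = k
      · simp [n, h1, ha.le, hb.le]
      · by_cases h2 : j = l
        · simp [n, h2, hkl.symm]
        · simpa [n, h1, h2] using hpos j
    · rw [← hs1]
      congr 1
      funext j
      by_cases h1 : j = k
      · simp [n, h1, hk]
      · by_cases h2 : j = l
        · simp [n, h2, hkl.symm, hl]
        · simp [n, h1, h2]
    · rw [← hs2, ← (Equiv.swap k l).tsum_eq (fun j => (m j).2)]
      congr 1
      funext j
      by_cases h1 : j = k
      · simp [n, h1, hl]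
      · by_cases h2 : j = l
        · simp [n, h2, hkl.symm, hk]
        · simp [n, h1, h2, Equiv.swap_apply_of_ne_of_ne h1 h2]
  have key := hle n hn
  let r : ℕ → ℝ≥0∞ := fun j => if j = k then 0 else if j = l then 0 else
    ENNReal.ofReal (e0 σ01 σ12 Γ11 0 Γ22 (m j))
  have hm' : energy σ01 σ12 Γ11 0 Γ22 m = ∑' j, r j
      + (ENNReal.ofReal (e0 σ01 σ12 Γ11 0 Γ22 (a, 0))
        + ENNReal.ofReal (e0 σ01 σ12 Γ11 0 Γ22 (0, b))) := by
    rw [← tsum_ite_eq k (fun _ => ENNReal.ofReal (e0 σ01 σ12 Γ11 0 Γ22 (a, 0))),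
      ← tsum_ite_eq l (fun _ => ENNReal.ofReal (e0 σ01 σ12 Γ11 0 Γ22 (0, b))),
      ← ENNReal.tsum_add, ← ENNReal.tsum_add]
    unfold energy
    congr 1
    funext j
    by_cases h1 : j = k
    · simp [r, h1, hk, hkl]
    · by_cases h2 : j = l
      · simp [r, h2, hkl.symm, hl]
      · simp [r, h1, h2]
  have hn' : energy σ01 σ12 Γ11 0 Γ22 n = ∑' j, r j
      + ENNReal.ofReal (e0 σ01 σ12 Γ11 0 Γ22 (a, b)) := by
    rw [← tsum_ite_eq k (fun _ => ENNReal.ofReal (e0 σ01 σ12 Γ11 0 Γ22 (a, b))),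
      ← ENNReal.tsum_add]
    unfold energy
    congr 1
    funext j
    by_cases h1 : j = k
    · simp [r, n, h1]
    · by_cases h2 : j = l
      · simp [r, n, h2, hkl.symm, e0]
      · simp [r, n, h1, h2]
  have hr : ∑' j, r j ≠ ⊤ := by
    intro h
    apply hfin
    rw [hm', h, top_add]
  rw [hm', hn'] at key
  exact absurd (ENNReal.add_lt_add_left hr hC) (not_lt.2 key)
end

section
/- Suppose Γ12 = 0 and M1, M2 > 0. Then every minimizing configuration (m^j)_{j∈ℕ} for the masses (M1, M2) contains at least one core shell: there exists an index k with m1^k > 0 and m2^k > 0. -/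
open scoped ENNReal

/-- when `Γ12 = 0`, every minimizing configuration contains
at least one core shell. -/
theorem exists_core_shell (σ01 σ12 Γ11 Γ12 Γ22 M1 M2 : ℝ)
    (hσ01 : 0 < σ01) (hσ12 : 0 < σ12)
    (hΓ11 : 0 ≤ Γ11) (hΓ12 : Γ12 = 0) (hΓ22 : 0 ≤ Γ22)
    (hM1 : 0 < M1) (hM2 : 0 < M2)
    (m : ℕ → ℝ × ℝ) (hmin : IsMinimizing σ01 σ12 Γ11 Γ12 Γ22 M1 M2 m) :
    ∃ k : ℕ, 0 < (m k).1 ∧ 0 < (m k).2 := by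
  subst hΓ12
  obtain ⟨⟨hnn, h1, h2⟩, hmin⟩ := hmin
  by_contra hcon
  push Not at hcon
  have hpi := Real.pi_pos
  obtain ⟨i, hi⟩ : ∃ i, 0 < (m i).1 := by
    by_contra h
    push Not at h
    have : ∀ k, (m k).1 = 0 := fun k => le_antisymm (h k) (hnn k).1
    simp [this] at h1
    linarith
  obtain ⟨j, hj⟩ : ∃ j, 0 < (m j).2 := by
    by_contra h
    push Not at h
    have : ∀ k, (m k).2 = 0 := fun k => le_antisymm (h k) (hnn k).2
    simp [this] at h2
    linarith
  have hi2 : (m i).2 = 0 := le_antisymm (hcon i hi) (hnn i).2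
  have hj1 : (m j).1 = 0 := by
    by_contra h
    have := hcon j (lt_of_le_of_ne (hnn j).1 (Ne.symm h))
    linarith
  have hij : j ≠ i := by
    rintro rfl
    linarith
  -- finiteness
  have hfin : energy σ01 σ12 Γ11 0 Γ22 m ≠ ⊤ := by
    have hc : IsConfig M1 M2 (fun k => if k = 0 then (M1, M2) else (0, 0)) := by
      refine ⟨fun k => ?_, ?_, ?_⟩
      · dsimp only
        split_ifs
        · exact ⟨hM1.le, hM2.le⟩
        · simp
      · rw [tsum_eq_single 0]
        · simp
        · intro b hb
          simp [hb]
      · rw [tsum_eq_single 0]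
        · simp
        · intro b hb
          simp [hb]
    refine ne_top_of_le_ne_top ?_ (hmin _ hc)
    unfold energy
    rw [tsum_eq_single 0]
    · exact ENNReal.ofReal_ne_top
    · intro b hb
      simp [hb, e0]
  let n : ℕ → ℝ × ℝ := fun k => ((m k).1, (m (Equiv.swap i j k)).2)
  have hn : IsConfig M1 M2 n := by
    refine ⟨fun k => ⟨(hnn k).1, (hnn _).2⟩, h1, ?_⟩
    rw [← h2]
    exact Equiv.tsum_eq (Equiv.swap i j) (fun k => (m k).2)
  have hle := hmin n hn
  have key : ∀ f : ℕ → ℝ≥0∞, ∑' k, f k =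
      (f i + f j) + ∑' k, if k = j then 0 else if k = i then 0 else f k := by
    intro f
    have step : ∀ (g : ℕ → ℝ≥0∞) (b : ℕ), ∑' k, g k = g b + ∑' k, if k = b then 0 else g k :=
      fun g b => Summable.tsum_eq_add_tsum_ite' b ENNReal.summable
    rw [step f i, step (fun k => if k = i then 0 else f k) j]
    simp [hij, add_assoc]
  unfold energy at hle hfin
  rw [key] at hfin
  rw [key, key (fun k => ENNReal.ofReal (e0 σ01 σ12 Γ11 0 Γ22 (n k)))] at hle
  have hrest : (∑' k, if k = j then 0 else if k = i then 0 else
        ENNReal.ofReal (e0 σ01 σ12 Γ11 0 Γ22 (n k))) =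
      ∑' k, if k = j then 0 else if k = i then 0 else
        ENNReal.ofReal (e0 σ01 σ12 Γ11 0 Γ22 (m k)) := by
    refine tsum_congr fun k => ?_
    split_ifs with ha hb
    · rfl
    · rfl
    · simp [n, Equiv.swap_apply_of_ne_of_ne hb ha]
  rw [hrest] at hle
  have hR := (ENNReal.add_ne_top.1 hfin).2
  rw [ENNReal.add_le_add_iff_right hR] at hle
  have e0nn : ∀ p : ℝ × ℝ, 0 ≤ e0 σ01 σ12 Γ11 0 Γ22 p := by
    intro p
    unfold e0
    have : 2 * (0:ℝ) * p.1 * p.2 = 0 := by ring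
    rw [this]
    positivity
  rw [← ENNReal.ofReal_add (e0nn _) (e0nn _), ← ENNReal.ofReal_add (e0nn _) (e0nn _),
    ENNReal.ofReal_le_ofReal_iff (add_nonneg (e0nn _) (e0nn _))] at hle
  have hsq : Real.sqrt (Real.pi * ((m i).1 + (m j).2)) <
      Real.sqrt (Real.pi * (m i).1) + Real.sqrt (Real.pi * (m j).2) := by
    have ha : 0 < Real.pi * (m i).1 := by positivity
    have hb : 0 < Real.pi * (m j).2 := by positivity
    have ha' := Real.sqrt_pos.2 ha
    have hb' := Real.sqrt_pos.2 hb
    rw [Real.sqrt_lt' (by positivity)]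
    have := mul_pos ha' hb'
    nlinarith [Real.sq_sqrt ha.le, Real.sq_sqrt hb.le]
  have := mul_lt_mul_of_pos_left hsq (by positivity : 0 < 2 * σ01)
  simp [e0, n, hi2, hj1] at hle
  simp only [mul_add] at hle this
  linarith
end

section
/- Suppose Γ := Γ11 + 2·Γ12 + Γ22 > 0 and let S > 0. Let m = (m1, m2) and n = (n1, n2) be pairs of nonnegative reals, both different from (0,0), with m1 + m2 ≤ S and n1 + n2 ≤ S. If e_0(m) + e_0(n) ≤ e_0(m1 + n1, m2 + n2), then min(m1 + m2, n1 + n2) ≥ 32·π³·σ01² / ((1+√2)²·Γ²·S²). -/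
set_option maxHeartbeats 2000000

/-- if merging two nonzero components `m`, `n` (each of total mass at
most `S`) does not decrease the energy, then each has total mass at least
`32π³σ01² / ((1+√2)²Γ²S²)` where `Γ = Γ11 + 2Γ12 + Γ22`. -/
theorem merging_mass_lower_bound (σ01 σ12 Γ11 Γ12 Γ22 S : ℝ)
    (hσ01 : 0 < σ01) (hσ12 : 0 < σ12)
    (hΓ11 : 0 ≤ Γ11) (hΓ12 : 0 ≤ Γ12) (hΓ22 : 0 ≤ Γ22)
    (hΓ : 0 < Γ11 + 2 * Γ12 + Γ22) (hS : 0 < S)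
    (m n : ℝ × ℝ)
    (hm1 : 0 ≤ m.1) (hm2 : 0 ≤ m.2) (hn1 : 0 ≤ n.1) (hn2 : 0 ≤ n.2)
    (hm0 : m ≠ (0, 0)) (hn0 : n ≠ (0, 0))
    (hmS : m.1 + m.2 ≤ S) (hnS : n.1 + n.2 ≤ S)
    (hmerge : e0 σ01 σ12 Γ11 Γ12 Γ22 m + e0 σ01 σ12 Γ11 Γ12 Γ22 n
      ≤ e0 σ01 σ12 Γ11 Γ12 Γ22 (m.1 + n.1, m.2 + n.2)) :
    32 * Real.pi ^ 3 * σ01 ^ 2 /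
        ((1 + Real.sqrt 2) ^ 2 * (Γ11 + 2 * Γ12 + Γ22) ^ 2 * S ^ 2)
      ≤ min (m.1 + m.2) (n.1 + n.2) := by
  obtain ⟨m1, m2⟩ := m
  obtain ⟨n1, n2⟩ := n
  simp only [e0] at *
  have hM : 0 < m1 + m2 := by
    rcases lt_or_eq_of_le (add_nonneg hm1 hm2) with h | h
    · exact h
    · exact absurd (Prod.ext (by simp; linarith) (by simp; linarith)) hm0
  have hN : 0 < n1 + n2 := by
    rcases lt_or_eq_of_le (add_nonneg hn1 hn2) with h | h
    · exact h
    · exact absurd (Prod.ext (by simp; linarith) (by simp; linarith)) hn0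
  have hpi := Real.pi_pos
  have hsum : m1 + n1 + (m2 + n2) = (m1 + m2) + (n1 + n2) := by ring
  rw [hsum] at hmerge
  have hsub : √(Real.pi * (m2 + n2)) ≤ √(Real.pi * m2) + √(Real.pi * n2) := by
    rw [mul_add]
    refine Real.sqrt_le_iff.2 ⟨by positivity, ?_⟩
    have h1 := Real.sq_sqrt (mul_nonneg hpi.le hm2)
    have h2 := Real.sq_sqrt (mul_nonneg hpi.le hn2)
    have h3 : 0 ≤ √(Real.pi * m2) * √(Real.pi * n2) := by positivity
    rw [add_sq]
    linarith
  have hsub' := mul_le_mul_of_nonneg_left hsub (by positivity : 0 ≤ 2 * σ12)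
  have hquad : Γ11 * (m1 * n1) + Γ12 * (m1 * n2 + m2 * n1) + Γ22 * (m2 * n2)
      ≤ (Γ11 + 2 * Γ12 + Γ22) * ((m1 + m2) * (n1 + n2)) := by
    have h1 := mul_nonneg hm1 hn1
    have h2 := mul_nonneg hm1 hn2
    have h3 := mul_nonneg hm2 hn1
    have h4 := mul_nonneg hm2 hn2
    have e1 : Γ11 * (m1 * n1) ≤ Γ11 * ((m1 + m2) * (n1 + n2)) :=
      mul_le_mul_of_nonneg_left (by nlinarith) hΓ11
    have e2 : Γ12 * (m1 * n2 + m2 * n1) ≤ Γ12 * (2 * ((m1 + m2) * (n1 + n2))) :=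
      mul_le_mul_of_nonneg_left (by nlinarith) hΓ12
    have e3 : Γ22 * (m2 * n2) ≤ Γ22 * ((m1 + m2) * (n1 + n2)) :=
      mul_le_mul_of_nonneg_left (by nlinarith) hΓ22
    linarith
  rw [Real.sqrt_mul hpi.le, Real.sqrt_mul hpi.le (n1 + n2),
    Real.sqrt_mul hpi.le (m1 + m2 + (n1 + n2))] at hmerge
  have hp := Real.sqrt_pos.2 hpi
  have hp2 := Real.sq_sqrt hpi.le
  have ha := Real.sqrt_pos.2 hM
  have ha2 := Real.sq_sqrt hM.le
  have hb := Real.sqrt_pos.2 hN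
  have hb2 := Real.sq_sqrt hN.le
  have hr := Real.sqrt_pos.2 (add_pos hM hN)
  have hr2 := Real.sq_sqrt (add_pos hM hN).le
  have hs := Real.sqrt_pos.2 (zero_lt_two (α := ℝ))
  have hs2 := Real.sq_sqrt (zero_le_two (α := ℝ))
  have hd : 2 * σ01 * √Real.pi * (√(m1 + m2) + √(n1 + n2) - √(m1 + m2 + (n1 + n2)))
      ≤ (1 / (4 * Real.pi)) * (2 * ((Γ11 + 2 * Γ12 + Γ22) * ((m1 + m2) * (n1 + n2)))) := by
    have h := mul_le_mul_of_nonneg_left hquad (by positivity : 0 ≤ 2 * (1 / (4 * Real.pi)))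
    linarith
  clear hmerge hquad hsub hsub'
  generalize Γ11 + 2 * Γ12 + Γ22 = G at *
  generalize m1 + m2 = M at *
  generalize n1 + n2 = N at *
  generalize √(M + N) = r at *
  generalize √M = a at *
  generalize √N = b at *
  generalize √Real.pi = p at *
  generalize √(2:ℝ) = s at *
  generalize Real.pi = q at *
  have hd2 : 4 * σ01 * p ^ 3 * (a + b - r) ≤ G * (a * b) ^ 2 := by
    have h := mul_le_mul_of_nonneg_left hd (by positivity : 0 ≤ 2 * q)
    have e : 2 * q * ((1 / (4 * q)) * (2 * (G * (M * N)))) = G * (M * N) := by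
      field_simp
      ring
    rw [e] at h
    rw [← ha2, ← hb2, ← hp2] at h
    linarith
  have hab : a + b ≤ s * r := by
    refine (sq_le_sq₀ (by positivity) (by positivity)).1 ?_
    rw [mul_pow, hs2, hr2]
    nlinarith [sq_nonneg (a - b)]
  have hK : 8 * σ01 * p ^ 3 ≤ G * (a * b) * ((1 + s) * r) := by
    have h1 := mul_le_mul_of_nonneg_right hd2 (by positivity : 0 ≤ a + b + r)
    have h2 : (a + b - r) * (a + b + r) = 2 * (a * b) := by nlinarith
    have h3 : G * (a * b) ^ 2 * (a + b + r) ≤ G * (a * b) ^ 2 * ((1 + s) * r) :=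
      mul_le_mul_of_nonneg_left (by linarith) (by positivity)
    rw [mul_assoc, h2] at h1
    refine le_of_mul_le_mul_right ?_ (mul_pos ha hb)
    linarith
  have hK2 := pow_le_pow_left₀ (by positivity) hK 2
  have e1 : (8 * σ01 * p ^ 3) ^ 2 = 64 * σ01 ^ 2 * q ^ 3 := by
    rw [← hp2]; ring
  have e2 : (G * (a * b) * ((1 + s) * r)) ^ 2 = (1 + s) ^ 2 * G ^ 2 * (M * N * (M + N)) := by
    rw [← hr2]
    calc _ = (1 + s) ^ 2 * G ^ 2 * (a ^ 2 * b ^ 2 * r ^ 2) := by ring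
      _ = _ := by rw [ha2, hb2]
  rw [e1, e2] at hK2
  have hC : 0 < (1 + s) ^ 2 * G ^ 2 := by positivity
  have hMN : M * N * (M + N) ≤ M * N * (2 * S) :=
    mul_le_mul_of_nonneg_left (by linarith) (by positivity)
  have f1 : M * N * (2 * S) ≤ 2 * (M * S ^ 2) := by
    have := mul_le_mul_of_nonneg_left hnS (by positivity : 0 ≤ 2 * M * S)
    linarith
  have f2 : M * N * (2 * S) ≤ 2 * (N * S ^ 2) := by
    have := mul_le_mul_of_nonneg_left hmS (by positivity : 0 ≤ 2 * N * S)
    linarith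
  apply le_min
  · rw [div_le_iff₀ (by positivity)]
    have := mul_le_mul_of_nonneg_left (hMN.trans f1) hC.le
    linarith
  · rw [div_le_iff₀ (by positivity)]
    have := mul_le_mul_of_nonneg_left (hMN.trans f2) hC.le
    linarith
end

section
/- For all real numbers a, b with 0 ≤ b ≤ a, one has √a + √b − √(a+b) ≥ (2 − √2)·√b, with equality if and only if b = 0 or a = b. -/
/-- for `0 ≤ b ≤ a`, `√a + √b − √(a+b) ≥ (2−√2)√b`, with equality
iff `b = 0` or `a = b`. -/
theorem sqrt_superadditivity_defect (a b : ℝ) (hb : 0 ≤ b) (hba : b ≤ a) :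
    (2 - Real.sqrt 2) * Real.sqrt b
      ≤ Real.sqrt a + Real.sqrt b - Real.sqrt (a + b) ∧
    (Real.sqrt a + Real.sqrt b - Real.sqrt (a + b)
        = (2 - Real.sqrt 2) * Real.sqrt b ↔ b = 0 ∨ a = b) := by
  have ha : 0 ≤ a := hb.trans hba
  have hxy : Real.sqrt b ≤ Real.sqrt a := Real.sqrt_le_sqrt hba
  have hx2 := Real.sq_sqrt ha
  have hy2 := Real.sq_sqrt hb
  have hz2 := Real.sq_sqrt (add_nonneg ha hb)
  have hs2 := Real.sq_sqrt (show (0:ℝ) ≤ 2 by norm_num)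
  have hx := Real.sqrt_nonneg a
  have hy := Real.sqrt_nonneg b
  have hz := Real.sqrt_nonneg (a + b)
  have hs : 1 < Real.sqrt 2 := by
    rw [Real.lt_sqrt] <;> norm_num
  generalize Real.sqrt a = x at *
  generalize Real.sqrt b = y at *
  generalize Real.sqrt (a + b) = z at *
  generalize Real.sqrt 2 = s at *
  have hw : 0 ≤ x + (s - 1) * y := by
    have := mul_nonneg (sub_nonneg.2 hs.le) hy
    linarith
  have key : (x + (s - 1) * y) ^ 2 = z ^ 2 + 2 * (s - 1) * (y * (x - y)) := by
    linear_combination hx2 + hy2 - hz2 + y ^ 2 * hs2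
  have hp : 0 ≤ 2 * (s - 1) * (y * (x - y)) :=
    mul_nonneg (by linarith) (mul_nonneg hy (by linarith))
  refine ⟨?_, ?_, ?_⟩
  · have : z ≤ x + (s - 1) * y := abs_le_of_sq_le_sq' (by linarith) hw |>.2
    linarith
  · intro h
    have h1 : x + (s - 1) * y = z := by linarith
    rw [h1] at key
    have h2 : 2 * (s - 1) * (y * (x - y)) = 0 := by linarith
    rcases mul_eq_zero.1 h2 with h3 | h3
    · linarith
    rcases mul_eq_zero.1 h3 with h4 | h4
    · left; rw [← hy2, h4]; norm_num
    · right; rw [← hx2, ← hy2, sub_eq_zero.1 h4]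
  · intro h
    have h0 : y * (x - y) = 0 := by
      rcases h with h | h
      · rw [h] at hy2
        rw [pow_eq_zero_iff (by norm_num)] at hy2
        simp [hy2]
      · have : x = y := (sq_eq_sq₀ hx hy).1 (by linarith)
        simp [this]
    rw [h0, mul_zero, add_zero] at key
    have := (sq_eq_sq₀ hw hz).1 key
    linarith
end

section
/- Let r > 0 and let p, q ∈ ℝ² with ‖p‖ < ‖q‖. Then ∫_{B_r(0)} log(1/‖x − q‖) dx < ∫_{B_r(0)} log(1/‖x − p‖) dx. In particular, the disk logarithmic potential P(p) := ∫_{B_r(0)} log(1/‖x − p‖) dx depends only on ‖p‖ and is a strictly decreasing function of ‖p‖. -/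
open MeasureTheory

lemma logInt (r : ℝ) (q : (EuclideanSpace ℝ (Fin 2))) :
    IntegrableOn (fun x : (EuclideanSpace ℝ (Fin 2)) => Real.log ‖x - q‖) (Metric.ball 0 r) := by
  have h1 : IntegrableOn (fun x : (EuclideanSpace ℝ (Fin 2)) => Real.log ‖x‖) (Metric.ball 0 (r + ‖q‖)) := by
    rw [integrableOn_fun_norm_addHaar volume (f := Real.log)]
    have : Continuous (fun y : ℝ => y * Real.log y) := Real.continuous_mul_log
    have h := (this.integrableOn_Icc (μ := volume) (a := 0) (b := r + ‖q‖)).mono_set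
      Set.Ioo_subset_Icc_self
    simpa using h
  have h2 := (measurePreserving_sub_right (volume : Measure (EuclideanSpace ℝ (Fin 2))) q).integrableOn_comp_preimage
    (measurableEmbedding_subRight q) (f := fun x : (EuclideanSpace ℝ (Fin 2)) => Real.log ‖x‖)
    (s := Metric.ball 0 (r + ‖q‖))
  have h3 := h2.2 h1
  refine h3.mono_set ?_
  intro x hx
  simp only [Metric.mem_ball, dist_zero_right, Set.mem_preimage] at *
  have := norm_sub_le x q
  linarith

lemma refl_data (p q : (EuclideanSpace ℝ (Fin 2))) (h : ‖p‖ < ‖q‖) : ∃ σ : (EuclideanSpace ℝ (Fin 2)) → (EuclideanSpace ℝ (Fin 2)),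
    Continuous σ ∧ MeasurableEmbedding σ ∧ MeasurePreserving σ volume volume ∧
    (∀ x, ‖σ x - p‖ = ‖x - q‖) ∧ (∀ x, ‖σ x - q‖ = ‖x - p‖) ∧
    (∀ x, (‖σ x‖ ^ 2 - ‖x‖ ^ 2) * ‖p - q‖ ^ 2
      = (‖x - q‖ ^ 2 - ‖x - p‖ ^ 2) * (‖q‖ ^ 2 - ‖p‖ ^ 2)) := by
  have hv : p - q ≠ 0 := by
    intro h0
    rw [sub_eq_zero.1 h0] at h
    exact lt_irrefl _ h
  have hV : ‖p - q‖ ^ 2 ≠ 0 := by positivity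
  set L : (EuclideanSpace ℝ (Fin 2)) ≃ₗᵢ[ℝ] (EuclideanSpace ℝ (Fin 2)) := (ℝ ∙ (p - q))ᗮ.reflection with hL
  have hLv : L (p - q) = -(p - q) := Submodule.reflection_orthogonalComplement_singleton_eq_neg _
  have hLq : L q + (q - L p) = p := by
    rw [map_sub] at hLv
    have : L q - L p = p - q := by rw [← neg_sub, hLv, neg_neg]
    calc L q + (q - L p) = (L q - L p) + q := by abel
      _ = p := by rw [this]; abel
  have hLp : L p + (q - L p) = q := by abel
  have hform : ∀ x, L x + (q - L p) = x + (-2 * inner ℝ (p - q) x / ‖p - q‖ ^ 2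
      + 2 * inner ℝ (p - q) p / ‖p - q‖ ^ 2 - 1) • (p - q) := by
    intro x
    rw [hL, Submodule.reflection_orthogonal_apply, Submodule.reflection_orthogonal_apply,
      Submodule.reflection_singleton_apply, Submodule.reflection_singleton_apply]
    simp only [RCLike.ofReal_real_eq_id, id]
    module
  refine ⟨fun x => L x + (q - L p), by fun_prop, ?_, ?_, ?_, ?_, ?_⟩
  · exact (measurableEmbedding_addRight (q - L p)).comp
      L.toHomeomorph.measurableEmbedding
  · exact (measurePreserving_add_right volume (q - L p)).comp L.measurePreserving
  · intro x
    have : L x + (q - L p) - p = L (x - q) := by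
      rw [map_sub]
      nth_rewrite 2 [← hLq]
      abel
    simp only [this, LinearIsometryEquiv.norm_map]
  · intro x
    have : L x + (q - L p) - q = L (x - p) := by
      rw [map_sub]; abel
    simp only [this, LinearIsometryEquiv.norm_map]
  · intro x
    simp only [hform]
    rw [norm_add_sq_real, norm_smul, mul_pow, Real.norm_eq_abs, sq_abs, inner_smul_right,
      norm_sub_sq_real x p, norm_sub_sq_real x q]
    have e1 : inner ℝ (p - q) p = ‖p‖ ^ 2 - inner ℝ p q := by
      rw [inner_sub_left, real_inner_self_eq_norm_sq, real_inner_comm]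
    have e2 : inner ℝ x (p - q) = inner ℝ x p - inner ℝ x q := inner_sub_right _ _ _
    rw [real_inner_comm x (p - q), e1, e2]
    have e3 := norm_sub_sq_real p q
    have e4 : inner ℝ p q = (‖p‖ ^ 2 + ‖q‖ ^ 2 - ‖p - q‖ ^ 2) / 2 := by linarith
    rw [e4]
    field_simp
    ring

lemma part1 (r : ℝ) (hr : 0 < r) (p q : (EuclideanSpace ℝ (Fin 2))) (h : ‖p‖ < ‖q‖) :
    (∫ x in Metric.ball (0 : (EuclideanSpace ℝ (Fin 2))) r, Real.log (1 / ‖x - q‖))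
        < ∫ x in Metric.ball (0 : (EuclideanSpace ℝ (Fin 2))) r, Real.log (1 / ‖x - p‖) := by
  obtain ⟨σ, hc, hme, hmp, hσp, hσq, hσ⟩ := refl_data p q h
  have hv : p - q ≠ 0 := by
    intro h0
    rw [sub_eq_zero.1 h0] at h
    exact lt_irrefl _ h
  have hw : 0 < ‖p - q‖ := norm_pos_iff.2 hv
  have hδ : 0 < ‖q‖ ^ 2 - ‖p‖ ^ 2 := by nlinarith [norm_nonneg p]
  set f : (EuclideanSpace ℝ (Fin 2)) → ℝ := fun x => Real.log ‖x - q‖ - Real.log ‖x - p‖ with hf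
  set B := Metric.ball (0 : (EuclideanSpace ℝ (Fin 2))) r with hB
  have hfi : IntegrableOn f B := (logInt r q).sub (logInt r p)
  set G : (EuclideanSpace ℝ (Fin 2)) → ℝ := B.indicator f with hG
  have hGi : Integrable G := hfi.integrable_indicator measurableSet_ball
  have hGσ : Integrable (fun x => G (σ x)) := (hmp.integrable_comp_emb hme).2 hGi
  have hfσ : ∀ x, f (σ x) = - f x := by
    intro x; simp only [hf, hσp, hσq]; ring
  have key : 0 < ∫ x, (G x + G (σ x)) := by
    have hp : ∀ x, x ≠ p → ‖x - p‖ ≤ ‖x - q‖ → 0 ≤ f x := by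
      intro x hx hxx
      have : 0 < ‖x - p‖ := norm_pos_iff.2 (sub_ne_zero.2 hx)
      exact sub_nonneg.2 (Real.log_le_log this hxx)
    have hn : ∀ x, x ≠ q → ‖x - q‖ ≤ ‖x - p‖ → f x ≤ 0 := by
      intro x hx hxx
      have : 0 < ‖x - q‖ := norm_pos_iff.2 (sub_ne_zero.2 hx)
      exact sub_nonpos.2 (Real.log_le_log this hxx)
    rw [integral_pos_iff_support_of_nonneg_ae]
    · -- positive measure of the support
      have hopen : IsOpen ({x : (EuclideanSpace ℝ (Fin 2)) | ‖x‖ < r} ∩ {x | r < ‖σ x‖} ∩ {x | ‖x - p‖ < ‖x - q‖}) := by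
        refine (IsOpen.inter ?_ ?_).inter ?_
        · exact isOpen_lt (by fun_prop) (by fun_prop)
        · exact isOpen_lt (by fun_prop) (by fun_prop)
        · exact isOpen_lt (by fun_prop) (by fun_prop)
      have hne : ({x : (EuclideanSpace ℝ (Fin 2)) | ‖x‖ < r} ∩ {x | r < ‖σ x‖} ∩ {x | ‖x - p‖ < ‖x - q‖}).Nonempty := by
        set w := ‖p - q‖ with hwdef
        set δ := ‖q‖ ^ 2 - ‖p‖ ^ 2 with hδdef
        obtain ⟨t, ht0, htr, htδ⟩ : ∃ t : ℝ, 0 ≤ t ∧ t < r ∧ r < t + δ / w := by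
          have : 0 < δ / w := by positivity
          refine ⟨max 0 (r - δ / w / 2), le_max_left _ _, max_lt hr (by linarith), ?_⟩
          have := le_max_right 0 (r - δ / w / 2)
          linarith
        have hx1 : ‖(t / w) • (p - q)‖ = t := by
          rw [norm_smul, Real.norm_eq_abs, abs_of_nonneg (by positivity), ← hwdef]
          field_simp
        have hx2 : ‖(t / w) • (p - q) - q‖ ^ 2 - ‖(t / w) • (p - q) - p‖ ^ 2 = 2 * t * w + δ := by
          rw [norm_sub_sq_real, norm_sub_sq_real, real_inner_smul_left, real_inner_smul_left]
          have : inner ℝ (p - q) p - inner ℝ (p - q) q = w ^ 2 := by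
            rw [← inner_sub_right, real_inner_self_eq_norm_sq]
          have h2 : t / w * inner ℝ (p - q) p - t / w * inner ℝ (p - q) q = t * w := by
            rw [← mul_sub, this]; field_simp
          linarith
        have hx3 := hσ ((t / w) • (p - q))
        rw [hx1, hx2] at hx3
        refine ⟨(t / w) • (p - q), ⟨?_, ?_⟩, ?_⟩
        · simpa [hx1] using htr
        · have : ‖σ ((t / w) • (p - q))‖ ^ 2 = (t + δ / w) ^ 2 := by
            have h4 : ‖σ ((t / w) • (p - q))‖ ^ 2 = t ^ 2 + (2 * t * w + δ) * δ / w ^ 2 := by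
              field_simp
              linarith
            rw [h4]; field_simp; ring
          have h5 : ‖σ ((t / w) • (p - q))‖ = t + δ / w :=
            (pow_left_inj₀ (norm_nonneg _) (by linarith) two_ne_zero).1 this
          simp only [Set.mem_ofPred_eq, h5]; exact htδ
        · simp only [Set.mem_ofPred_eq]
          apply lt_of_pow_lt_pow_left₀ 2 (norm_nonneg _)
          nlinarith [mul_nonneg ht0 hw.le]
      have hpos := (hopen.sdiff (isClosed_singleton (x := p)))
      have hpos2 := hopen.measure_pos (volume : Measure (EuclideanSpace ℝ (Fin 2))) hne
      rw [← measure_sdiff_null (measure_singleton p)] at hpos2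
      refine hpos2.trans_le (measure_mono ?_)
      rintro x ⟨⟨⟨hx1, hx2⟩, hx3⟩, hx4⟩
      have hxp : 0 < ‖x - p‖ := norm_pos_iff.2 (sub_ne_zero.2 hx4)
      have h1 : x ∈ B := by simpa [hB] using hx1
      have h2 : σ x ∉ B := by simpa [hB] using (le_of_lt hx2)
      have : 0 < f x := sub_pos.2 (Real.log_lt_log hxp hx3)
      simp only [Function.mem_support, hG, Set.indicator_of_mem h1, Set.indicator_of_notMem h2]
      simpa using this.ne'
    · have ae1 : ∀ᵐ x : (EuclideanSpace ℝ (Fin 2)), x ≠ p := by simp [ae_iff]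
      have ae2 : ∀ᵐ x : (EuclideanSpace ℝ (Fin 2)), x ≠ q := by simp [ae_iff]
      filter_upwards [ae1, ae2] with x hx1 hx2
      have hx := hσ x
      simp only [Pi.zero_apply, hG, Set.indicator]
      rw [hfσ]
      have hw2 : 0 < ‖p - q‖ ^ 2 := by positivity
      rcases le_total ‖x - p‖ ‖x - q‖ with hle | hle
      · have h0 := hp x hx1 hle
        have h1 : ‖x‖ ≤ ‖σ x‖ := by
          apply le_of_sq_le_sq _ (norm_nonneg _)
          have : 0 ≤ ‖x - q‖ ^ 2 - ‖x - p‖ ^ 2 := by nlinarith [norm_nonneg (x - p)]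
          have := nonneg_of_mul_nonneg_left (hx ▸ mul_nonneg this hδ.le) hw2
          linarith
        simp only [hB, Metric.mem_ball, dist_zero_right]
        split_ifs <;> linarith
      · have h0 := hn x hx2 hle
        have h1 : ‖σ x‖ ≤ ‖x‖ := by
          apply le_of_sq_le_sq _ (norm_nonneg _)
          have : 0 ≤ ‖x - p‖ ^ 2 - ‖x - q‖ ^ 2 := by nlinarith [norm_nonneg (x - q)]
          have h7 : 0 ≤ (‖x‖ ^ 2 - ‖σ x‖ ^ 2) * ‖p - q‖ ^ 2 := by
            nlinarith [mul_nonneg this hδ.le]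
          have := nonneg_of_mul_nonneg_left h7 hw2
          linarith
        simp only [hB, Metric.mem_ball, dist_zero_right]
        split_ifs <;> linarith
    · exact hGi.add hGσ
  rw [integral_add hGi hGσ, hmp.integral_comp hme] at key
  have hint : ∫ x, G x = (∫ x in B, Real.log ‖x - q‖) - ∫ x in B, Real.log ‖x - p‖ := by
    rw [hG, integral_indicator measurableSet_ball]
    exact integral_sub (logInt r q) (logInt r p)
  simp only [one_div, Real.log_inv, integral_neg]
  linarith

lemma part2 (r : ℝ) (p q : (EuclideanSpace ℝ (Fin 2))) (h : ‖p‖ = ‖q‖) :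
    (∫ x in Metric.ball (0 : (EuclideanSpace ℝ (Fin 2))) r, Real.log (1 / ‖x - p‖))
        = ∫ x in Metric.ball (0 : (EuclideanSpace ℝ (Fin 2))) r, Real.log (1 / ‖x - q‖) := by
  set L : (EuclideanSpace ℝ (Fin 2)) ≃ₗᵢ[ℝ] (EuclideanSpace ℝ (Fin 2)) := (ℝ ∙ (p - q))ᗮ.reflection with hL
  have hLp : L p = q := Submodule.reflection_sub h
  rw [← L.measurePreserving.setIntegral_preimage_emb L.toHomeomorph.measurableEmbedding
    (fun x => Real.log (1 / ‖x - q‖))]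
  have h1 : L ⁻¹' Metric.ball 0 r = Metric.ball 0 r := by
    ext x; simp
  rw [h1, ← hLp]
  simp only [← map_sub, LinearIsometryEquiv.norm_map]

/-- the logarithmic potential of a disk,
`P(p) = ∫_{B_r(0)} log(1/‖x−p‖) dx`, depends only on `‖p‖` and is a strictly
decreasing function of `‖p‖`. -/
theorem log_potential_radial_strict_anti (r : ℝ) (hr : 0 < r) :
    (∀ p q : EuclideanSpace ℝ (Fin 2), ‖p‖ < ‖q‖ →
      (∫ x in Metric.ball (0 : EuclideanSpace ℝ (Fin 2)) r, Real.log (1 / ‖x - q‖))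
        < ∫ x in Metric.ball (0 : EuclideanSpace ℝ (Fin 2)) r, Real.log (1 / ‖x - p‖)) ∧
    (∀ p q : EuclideanSpace ℝ (Fin 2), ‖p‖ = ‖q‖ →
      (∫ x in Metric.ball (0 : EuclideanSpace ℝ (Fin 2)) r, Real.log (1 / ‖x - p‖))
        = ∫ x in Metric.ball (0 : EuclideanSpace ℝ (Fin 2)) r, Real.log (1 / ‖x - q‖)) := by
  exact ⟨fun p q h => part1 r hr p q h, fun p q h => part2 r p q h⟩
end

section
/- Let r > 0 and t > 0, and let e₁ = (1, 0) ∈ ℝ². Then ∫_{B_r(0)} (x₁ − t)/‖x − t·e₁‖² dx < 0, where x₁ denotes the first coordinate of x. -/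
open MeasureTheory

theorem aux_integrableOn (r t : ℝ) (ht : 0 < t) :
    IntegrableOn (fun x : EuclideanSpace ℝ (Fin 2) =>
      (x 0 - t) / ‖x - t • EuclideanSpace.single (0 : Fin 2) (1 : ℝ)‖ ^ 2)
      (Metric.ball (0 : EuclideanSpace ℝ (Fin 2)) r) := by
  set c : EuclideanSpace ℝ (Fin 2) := t • EuclideanSpace.single (0 : Fin 2) (1 : ℝ) with hc
  have hcn : ‖c‖ = t := by simp [hc, norm_smul, abs_of_pos ht]
  have hm : Measurable (fun y : EuclideanSpace ℝ (Fin 2) => y 0 / ‖y‖ ^ 2) := by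
    fun_prop
  have h1 : IntegrableOn (fun y : EuclideanSpace ℝ (Fin 2) => y 0 / ‖y‖ ^ 2)
      (Metric.ball 0 (r + t)) volume := by
    refine integrableOn_ball_of_norm_le_rpow (C := 1) (α := 1) (by simp) (by simp) ?_
      hm.aestronglyMeasurable
    refine Filter.Eventually.of_forall fun y => ?_
    rw [Real.rpow_neg_one, one_mul, norm_div, norm_pow, norm_norm]
    rcases eq_or_ne ‖y‖ 0 with h | h
    · simp [h]
    · have h0 : 0 < ‖y‖ := lt_of_le_of_ne (norm_nonneg _) h.symm
      have := PiLp.norm_apply_le y 0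
      rw [div_le_iff₀ (by positivity)]
      field_simp
      exact this
  rw [← integrable_indicator_iff measurableSet_ball] at h1
  have h2 := (h1.comp_sub_right c).integrableOn (s := Metric.ball 0 r)
  refine h2.congr_fun ?_ measurableSet_ball
  intro x hx
  have hx' : x - c ∈ Metric.ball (0 : EuclideanSpace ℝ (Fin 2)) (r + t) := by
    rw [mem_ball_zero_iff] at hx ⊢
    have := norm_sub_le x c
    linarith
  simp only [Set.indicator_of_mem hx']
  simp [hc]

/-- for `r, t > 0`,
`∫_{B_r(0)} (x₁ − t)/‖x − t e₁‖² dx < 0` in the plane. -/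
theorem derivative_of_log_potential_neg (r t : ℝ) (hr : 0 < r) (ht : 0 < t) :
    (∫ x in Metric.ball (0 : EuclideanSpace ℝ (Fin 2)) r,
        (x 0 - t) / ‖x - t • EuclideanSpace.single (0 : Fin 2) (1 : ℝ)‖ ^ 2) < 0 := by
  have hint := aux_integrableOn r t ht
  set c : EuclideanSpace ℝ (Fin 2) := t • EuclideanSpace.single (0 : Fin 2) (1 : ℝ) with hc
  set f : EuclideanSpace ℝ (Fin 2) → ℝ := fun x => (x 0 - t) / ‖x - c‖ ^ 2 with hf
  have hc0 : c 0 = t := by simp [hc]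
  have hc1 : c 1 = 0 := by simp [hc]
  set B := Metric.ball (0 : EuclideanSpace ℝ (Fin 2)) r with hB
  set B' := Metric.ball (c + c) r with hB'
  have hodd : ∀ x, f (c + c - x) = - f x := by
    intro x
    have h1 : c + c - x - c = -(x - c) := by abel
    simp only [hf, h1, norm_neg, PiLp.sub_apply, PiLp.add_apply, hc0]
    ring
  have hmem : ∀ x, c + c - x ∈ B ∩ B' ↔ x ∈ B ∩ B' := by
    intro x
    simp only [hB, hB', Set.mem_inter_iff, mem_ball_iff_norm, sub_zero]
    rw [show c + c - x - (c + c) = -x by abel, norm_neg, norm_sub_rev (c + c) x]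
    exact and_comm
  have hz : ∫ x in B ∩ B', f x = 0 := by
    have hms : MeasurableSet (B ∩ B') := measurableSet_ball.inter measurableSet_ball
    rw [← integral_indicator hms]
    have h := integral_sub_left_eq_self ((B ∩ B').indicator f) volume (c + c)
    have h2 : ∀ x, (B ∩ B').indicator f (c + c - x) = - (B ∩ B').indicator f x := by
      intro x
      by_cases hx : x ∈ B ∩ B'
      · rw [Set.indicator_of_mem hx, Set.indicator_of_mem ((hmem x).2 hx), hodd]
      · rw [Set.indicator_of_notMem hx, Set.indicator_of_notMem (fun h => hx ((hmem x).1 h)),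
          neg_zero]
    simp only [h2, integral_neg] at h
    linarith
  have hneg : ∀ x ∈ B \ B', f x < 0 := by
    rintro x ⟨h1, h2⟩
    rw [hB, mem_ball_zero_iff] at h1
    rw [hB', mem_ball_iff_norm, not_lt] at h2
    have h3 : ‖x‖ ^ 2 < ‖x - (c + c)‖ ^ 2 := by
      have := h1.trans_le h2
      gcongr
    simp only [EuclideanSpace.real_norm_sq_eq, Fin.sum_univ_two, PiLp.sub_apply, PiLp.add_apply,
      hc0, hc1] at h3
    have h4 : x 0 < t := by nlinarith
    have h5 : x - c ≠ 0 := by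
      intro h
      have : x 0 = c 0 := by rw [sub_eq_zero.1 h]
      linarith
    have : 0 < ‖x - c‖ := norm_pos_iff.2 h5
    exact div_neg_of_neg_of_pos (by linarith) (by positivity)
  have hsplit : ∫ x in B, f x = (∫ x in B ∩ B', f x) + ∫ x in B \ B', f x :=
    (integral_inter_add_sdiff measurableSet_ball hint).symm
  have hpos : 0 < ∫ x in B \ B', - f x := by
    rw [setIntegral_pos_iff_support_of_nonneg_ae]
    · have hU : IsOpen (B ∩ (Metric.closedBall (c + c) r)ᶜ) :=
        Metric.isOpen_ball.inter Metric.isClosed_closedBall.isOpen_compl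
      have hne : (B ∩ (Metric.closedBall (c + c) r)ᶜ).Nonempty := by
        refine ⟨(-max 0 (r - t)) • EuclideanSpace.single (0 : Fin 2) (1 : ℝ), ?_, ?_⟩
        · rw [hB, mem_ball_zero_iff, norm_smul]
          simp only [EuclideanSpace.norm_single, norm_one, mul_one, Real.norm_eq_abs, abs_neg]
          rw [abs_of_nonneg (le_max_left _ _)]
          exact max_lt hr (by linarith)
        · rw [Set.mem_compl_iff, mem_closedBall_iff_norm, not_le, hc, ← add_smul, ← sub_smul,
            norm_smul]
          simp only [EuclideanSpace.norm_single, norm_one, mul_one, Real.norm_eq_abs]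
          refine lt_of_lt_of_le ?_ (neg_le_abs _)
          linarith [le_max_right 0 (r - t)]
      refine (hU.measure_pos volume hne).trans_le (measure_mono ?_)
      rintro x ⟨h1, h2⟩
      have h3 : x ∈ B \ B' := ⟨h1, fun h => h2 (Metric.ball_subset_closedBall h)⟩
      exact ⟨by simpa using (hneg x h3).ne, h3⟩
    · filter_upwards [ae_restrict_mem (measurableSet_ball.diff measurableSet_ball)] with x hx
      have := hneg x hx
      simp only [Pi.zero_apply]
      linarith
    · exact (hint.mono_set Set.sdiff_subset).neg
  rw [integral_neg] at hpos
  change ∫ x in B, f x < 0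
  linarith
end

section
/- Let 0 < r2 < r1. For p ∈ ℝ² with ‖p‖ ≤ r1 − r2 define I(p) := ∫_{B_{r1}(0) \ B_{r2}(p)} ∫_{B_{r2}(p)} log(1/‖x − y‖) dy dx. Then I(p) depends only on ‖p‖, and whenever ‖p‖ < ‖q‖ ≤ r1 − r2 one has I(q) < I(p). In particular I attains its maximum over {‖p‖ ≤ r1 − r2} exactly at p = 0 and its minimum exactly at the points with ‖p‖ = r1 − r2. -/
open MeasureTheory

/-- The cross interaction `I(p)` between the annular region `B_{r1}(0) \ B_{r2}(p)`
and the inner disk `B_{r2}(p)` of a (generalized) core shell. -/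
noncomputable def coreShellCross (r1 r2 : ℝ) (p : EuclideanSpace ℝ (Fin 2)) : ℝ :=
  ∫ x in Metric.ball (0 : EuclideanSpace ℝ (Fin 2)) r1 \ Metric.ball p r2,
    ∫ y in Metric.ball p r2, Real.log (1 / ‖x - y‖)

lemma radial_int (ρ R : ℝ) (h0 : 0 ≤ ρ) (hR : ρ ≤ R) :
    ∫ r in (0:ℝ)..R, r * Real.log (max r ρ) =
      R ^ 2 / 2 * Real.log R - R ^ 2 / 4 + ρ ^ 2 / 4 := by
  have c1 : Continuous fun r : ℝ => r * Real.log r := Real.continuous_mul_log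
  have e1 : ∫ r in (0:ℝ)..ρ, r * Real.log (max r ρ) = ρ ^ 2 / 2 * Real.log ρ := by
    have : ∫ r in (0:ℝ)..ρ, r * Real.log (max r ρ) = ∫ r in (0:ℝ)..ρ, r * Real.log ρ := by
      apply intervalIntegral.integral_congr
      intro r hr
      rw [Set.uIcc_of_le h0] at hr
      simp [max_eq_right hr.2]
    rw [this]; simp
  have e2' : Set.EqOn (fun r : ℝ => r * Real.log (max r ρ)) (fun r => r * Real.log r) (Set.uIcc ρ R) := by
    intro r hr
    rw [Set.uIcc_of_le hR] at hr
    simp [max_eq_left hr.1]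
  have e2 : ∫ r in ρ..R, r * Real.log (max r ρ) =
      (R ^ 2 / 2 * Real.log R - R ^ 2 / 4) - (ρ ^ 2 / 2 * Real.log ρ - ρ ^ 2 / 4) := by
    rw [intervalIntegral.integral_congr e2']
    refine intervalIntegral.integral_eq_sub_of_hasDerivAt_of_le hR
      (f := fun r => r ^ 2 / 2 * Real.log r - r ^ 2 / 4) ?_ ?_ (c1.intervalIntegrable _ _)
    · apply Continuous.continuousOn
      have : (fun r : ℝ => r ^ 2 / 2 * Real.log r - r ^ 2 / 4) =
        fun r : ℝ => r / 2 * (r * Real.log r) - r ^ 2 / 4 := by ext; ring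
      rw [this]; fun_prop
    · intro x hx
      have hx0 : x ≠ 0 := (lt_of_le_of_lt h0 hx.1).ne'
      have := (((hasDerivAt_pow 2 x).div_const 2).mul (Real.hasDerivAt_log hx0)).sub
        ((hasDerivAt_pow 2 x).div_const 4)
      refine this.congr_deriv ?_
      simp only [Nat.cast_ofNat, Nat.add_one_sub_one, pow_one]
      field_simp
      ring
  have i1 : IntervalIntegrable (fun r : ℝ => r * Real.log (max r ρ)) volume 0 ρ := by
    have : IntervalIntegrable (fun r : ℝ => r * Real.log ρ) volume 0 ρ :=
      (by fun_prop : Continuous fun r : ℝ => r * Real.log ρ).intervalIntegrable _ _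
    refine IntervalIntegrable.congr (fun r hr => ?_) this
    rw [Set.uIoc_of_le h0] at hr
    simp [max_eq_right hr.2]
  have i2 : IntervalIntegrable (fun r : ℝ => r * Real.log (max r ρ)) volume ρ R :=
    IntervalIntegrable.congr (fun r hr => (e2' (Set.uIoc_subset_uIcc hr)).symm) (c1.intervalIntegrable _ _)
  rw [← intervalIntegral.integral_add_adjacent_intervals i1 i2, e1, e2]
  ring

lemma polar_avg (F : ℂ → ℝ) (hm : Measurable F) (hF : Integrable F) :
    ∫ z, F z = ∫ r in Set.Ioi (0:ℝ), r * (2 * Real.pi * Real.circleAverage F 0 r) := by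
  have hsm : Measurable (Complex.polarCoord.symm : ℝ × ℝ → ℂ) := by
    have : (Complex.polarCoord.symm : ℝ × ℝ → ℂ) =
        fun p => p.1 * (Real.cos p.2 + Real.sin p.2 * Complex.I) := by
      ext p; exact Complex.polarCoord_symm_apply p
    rw [this]; fun_prop
  have hi : IntegrableOn (fun p : ℝ × ℝ => p.1 • F (Complex.polarCoord.symm p))
      (Set.Ioi (0:ℝ) ×ˢ Set.Ioo (-Real.pi) Real.pi) (volume.prod volume) := by
    refine ⟨?_, ?_⟩
    · exact (Measurable.smul measurable_fst (hm.comp hsm)).aestronglyMeasurable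
    · have h2 := hF.2
      rw [hasFiniteIntegral_iff_enorm] at h2 ⊢
      rw [← Complex.lintegral_comp_polarCoord_symm] at h2
      refine lt_of_eq_of_lt ?_ h2
      rw [polarCoord_target]
      refine setLIntegral_congr_fun (measurableSet_Ioi.prod measurableSet_Ioo) ?_
      intro p hp
      simp only [smul_eq_mul, enorm_mul]
      congr 1
      exact Real.enorm_of_nonneg (le_of_lt hp.1)
  rw [← Complex.integral_comp_polarCoord_symm, polarCoord_target]
  rw [Measure.volume_eq_prod, setIntegral_prod _ hi]
  refine setIntegral_congr_fun measurableSet_Ioi ?_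
  intro r hr
  simp only [smul_eq_mul]
  rw [integral_const_mul]
  congr 1
  rw [Real.circleAverage_eq_integral_add (-Real.pi), intervalIntegral.integral_comp_add_right
    (fun t => F (circleMap 0 r t))]
  rw [← integral_Ioc_eq_integral_Ioo, ← intervalIntegral.integral_of_le (by linarith [Real.pi_pos])]
  have : (2 * Real.pi + -Real.pi) = Real.pi := by ring
  rw [this, zero_add, smul_eq_mul, ← mul_assoc, mul_inv_cancel₀ (by positivity), one_mul]
  apply intervalIntegral.integral_congr
  intro t _
  simp only [Complex.polarCoord_symm_apply, circleMap, Complex.exp_mul_I, zero_add]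
  simp

lemma log_int_ball {E : Type*} [NormedAddCommGroup E] [InnerProductSpace ℝ E]
    [MeasurableSpace E] [BorelSpace E] [FiniteDimensional ℝ E] (hd : Module.finrank ℝ E = 2) (R : ℝ) :
    IntegrableOn (fun x : E => Real.log ‖x‖) (Metric.ball 0 R) := by
  haveI : Nontrivial E := Module.nontrivial_of_finrank_pos (R := ℝ) (by omega)
  rw [integrableOn_fun_norm_addHaar, hd]
  have c1 : Continuous fun r : ℝ => r * Real.log r := Real.continuous_mul_log
  simpa using (c1.integrableOn_Icc (a := 0) (b := R)).mono_set Set.Ioo_subset_Icc_self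

lemma log_int_prod {E : Type*} [NormedAddCommGroup E] [InnerProductSpace ℝ E]
    [MeasurableSpace E] [BorelSpace E] [FiniteDimensional ℝ E] (hd : Module.finrank ℝ E = 2) (R : ℝ) :
    IntegrableOn (fun z : E × E => Real.log ‖z.1 - z.2‖) (Metric.ball 0 R ×ˢ Metric.ball 0 R)
      (volume.prod volume) := by
  have hf : Integrable ((Metric.ball (0:E) R).indicator (fun _ => (1:ℝ))) :=
    (integrable_indicator_iff measurableSet_ball).2
      (integrableOn_const measure_ball_lt_top.ne)
  have hg : Integrable ((Metric.ball (0:E) (R + R)).indicator (fun x => Real.log ‖x‖)) :=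
    (integrable_indicator_iff measurableSet_ball).2 (log_int_ball hd _)
  have := (hf.convolution_integrand (ContinuousLinearMap.mul ℝ ℝ) hg).integrableOn
    (s := Metric.ball 0 R ×ˢ Metric.ball 0 R)
  refine this.congr_fun ?_ (measurableSet_ball.prod measurableSet_ball)
  rintro ⟨x, y⟩ ⟨hx, hy⟩
  have h3 : x - y ∈ Metric.ball (0:E) (R + R) := by
    simp only [mem_ball_zero_iff] at hx hy ⊢
    linarith [norm_sub_le x y]
  simp [Set.indicator_of_mem hy, Set.indicator_of_mem h3]

lemma log_int_sub {E : Type*} [NormedAddCommGroup E] [InnerProductSpace ℝ E]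
    [MeasurableSpace E] [BorelSpace E] [FiniteDimensional ℝ E] (hd : Module.finrank ℝ E = 2) (R : ℝ)
    (a : E) :
    IntegrableOn (fun x : E => Real.log ‖x - a‖) (Metric.ball 0 R) := by
  have hg : Integrable ((Metric.ball (0:E) (R + ‖a‖)).indicator (fun x => Real.log ‖x‖)) :=
    (integrable_indicator_iff measurableSet_ball).2 (log_int_ball hd _)
  have := (hg.comp_sub_right a).integrableOn (s := Metric.ball 0 R)
  refine this.congr_fun ?_ measurableSet_ball
  intro x hx
  have h3 : x - a ∈ Metric.ball (0:E) (R + ‖a‖) := by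
    simp only [mem_ball_zero_iff] at hx ⊢
    linarith [norm_sub_le x a]
  simp [Set.indicator_of_mem h3]

lemma pot_complex (R : ℝ) (a : ℂ) (ha : ‖a‖ ≤ R) :
    ∫ z in Metric.ball (0:ℂ) R, Real.log ‖z - a‖ =
      2 * Real.pi * (R ^ 2 / 2 * Real.log R - R ^ 2 / 4 + ‖a‖ ^ 2 / 4) := by
  have hR : 0 ≤ R := (norm_nonneg a).trans ha
  rw [← integral_indicator measurableSet_ball, polar_avg]
  rotate_left
  · exact Measurable.indicator (by fun_prop) measurableSet_ball
  · exact (integrable_indicator_iff measurableSet_ball).2 (log_int_sub Complex.finrank_real_complex _ _)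
  have key : ∀ r ∈ Set.Ioi (0:ℝ), r * (2 * Real.pi * Real.circleAverage
      ((Metric.ball (0:ℂ) R).indicator fun z => Real.log ‖z - a‖) 0 r) =
      (Set.Iio R).indicator (fun r => 2 * Real.pi * (r * Real.log (max r ‖a‖))) r := by
    intro r hr
    have hr' : 0 < r := hr
    by_cases h : r < R
    · rw [Set.indicator_of_mem (show r ∈ Set.Iio R from h)]
      have e : Real.circleAverage ((Metric.ball (0:ℂ) R).indicator fun z => Real.log ‖z - a‖) 0 r
          = Real.circleAverage (fun z => Real.log ‖z - a‖) 0 r := by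
        apply Real.circleAverage_congr_sphere
        intro z hz
        rw [Set.indicator_of_mem]
        rw [mem_sphere_zero_iff_norm, abs_of_pos hr'] at hz
        rw [mem_ball_zero_iff, hz]; exact h
      rw [e, circleAverage_log_norm_sub_const_eq_log_radius_add_posLog hr'.ne']
      have : Real.log r + Real.posLog (r⁻¹ * ‖0 - a‖) = Real.log (max r ‖a‖) := by
        rw [zero_sub, norm_neg, Real.posLog]
        rcases le_total r ‖a‖ with h1 | h1
        · have h2 : 0 < ‖a‖ := hr'.trans_le h1
          rw [max_eq_right h1, max_eq_right, Real.log_mul (by positivity) h2.ne', Real.log_inv]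
          · ring
          · apply Real.log_nonneg
            rw [inv_mul_eq_div, le_div_iff₀ hr']; linarith
        · rw [max_eq_left h1, max_eq_left, add_zero]
          apply Real.log_nonpos (by positivity)
          rw [inv_mul_eq_div, div_le_iff₀ hr']; linarith
      rw [this]; ring
    · rw [Set.indicator_of_notMem (show r ∉ Set.Iio R from h)]
      have e : Real.circleAverage ((Metric.ball (0:ℂ) R).indicator fun z => Real.log ‖z - a‖) 0 r
          = Real.circleAverage (fun z => (0:ℝ)) 0 r := by
        apply Real.circleAverage_congr_sphere
        intro z hz
        rw [Set.indicator_of_notMem]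
        rw [mem_sphere_zero_iff_norm, abs_of_pos hr'] at hz
        rw [mem_ball_zero_iff, hz]; exact h
      rw [e, Real.circleAverage_const]; simp
  rw [setIntegral_congr_fun measurableSet_Ioi key, setIntegral_indicator measurableSet_Iio,
    Set.Ioi_inter_Iio, ← integral_Ioc_eq_integral_Ioo, ← intervalIntegral.integral_of_le hR,
    intervalIntegral.integral_const_mul, radial_int _ _ (norm_nonneg a) ha]

local notation "E2" => EuclideanSpace ℝ (Fin 2)

lemma pot_eucl (R : ℝ) (a : E2) (ha : ‖a‖ ≤ R) :
    ∫ z in Metric.ball (0:E2) R, Real.log ‖z - a‖ =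
      2 * Real.pi * (R ^ 2 / 2 * Real.log R - R ^ 2 / 4 + ‖a‖ ^ 2 / 4) := by
  let e : ℂ ≃ₗᵢ[ℝ] E2 := Complex.orthonormalBasisOneI.repr
  have h := pot_complex R (e.symm a) (by simpa using ha)
  rw [e.symm.norm_map] at h
  rw [← h, ← e.measurePreserving.setIntegral_preimage_emb e.toHomeomorph.measurableEmbedding]
  have : e ⁻¹' Metric.ball (0:E2) R = Metric.ball 0 R := by
    ext z; simp
  rw [this]
  congr 1
  ext z
  rw [← e.norm_map (z - e.symm a)]
  simp

lemma sq_int (r : ℝ) (p : E2) (A B : ℝ) :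
    ∫ y in Metric.ball p r, (A + B * ‖y‖ ^ 2) =
      (∫ y in Metric.ball (0:E2) r, (A + B * ‖y‖ ^ 2)) +
        B * ‖p‖ ^ 2 * volume.real (Metric.ball (0:E2) r) := by
  have hc : ∀ f : E2 → ℝ, Continuous f → IntegrableOn f (Metric.ball (0:E2) r) := fun f hf =>
    (hf.continuousOn.integrableOn_compact (isCompact_closedBall (0:E2) r)).mono_set
      Metric.ball_subset_closedBall
  have t : ∫ y in Metric.ball p r, (A + B * ‖y‖ ^ 2) =
      ∫ y in Metric.ball (0:E2) r, (A + B * ‖y + p‖ ^ 2) := by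
    rw [← (measurePreserving_add_right volume p).setIntegral_preimage_emb
      (measurableEmbedding_addRight p)]
    congr 2
    ext z; simp [dist_eq_norm]
  have odd : ∫ y in Metric.ball (0:E2) r, inner ℝ y p = 0 := by
    have h := (Measure.measurePreserving_neg (volume : Measure E2)).setIntegral_preimage_emb
      (MeasurableEquiv.neg E2).measurableEmbedding (fun y => inner ℝ y p) (Metric.ball 0 r)
    have e : (Neg.neg ⁻¹' Metric.ball (0:E2) r) = Metric.ball 0 r := by ext z; simp
    rw [e] at h
    simp only [inner_neg_left, integral_neg] at h
    linarith
  have : ∀ y : E2, A + B * ‖y + p‖ ^ 2 = (A + B * ‖y‖ ^ 2) + (2 * B * inner ℝ y p + B * ‖p‖ ^ 2) := by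
    intro y; rw [norm_add_sq_real]; ring
  rw [t]
  simp_rw [this]
  rw [integral_add (hc _ (by fun_prop)) (hc _ (by fun_prop)),
    integral_add (f := fun y : E2 => 2 * B * inner ℝ y p) (hc _ (by fun_prop)) (hc _ (by fun_prop)),
    integral_const_mul (2 * B) (fun y : E2 => inner ℝ y p), odd, setIntegral_const, smul_eq_mul]
  ring

lemma self_int (r : ℝ) (p : E2) :
    ∫ x in Metric.ball p r, ∫ y in Metric.ball p r, Real.log (1 / ‖x - y‖) =
    ∫ x in Metric.ball (0:E2) r, ∫ y in Metric.ball (0:E2) r, Real.log (1 / ‖x - y‖) := by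
  have e : (fun x : E2 => x + p) ⁻¹' Metric.ball p r = Metric.ball 0 r := by
    ext z; simp [dist_eq_norm]
  have t : ∀ f : E2 → ℝ, ∫ y in Metric.ball p r, f y = ∫ y in Metric.ball (0:E2) r, f (y + p) := by
    intro f
    rw [← (measurePreserving_add_right volume p).setIntegral_preimage_emb
      (measurableEmbedding_addRight p), e]
  rw [t]
  simp_rw [t]
  simp

lemma cross_formula (r1 r2 : ℝ) : ∃ C : ℝ, ∀ p : E2, ‖p‖ ≤ r1 - r2 →
    coreShellCross r1 r2 p =
      C - Real.pi / 2 * volume.real (Metric.ball (0:E2) r2) * ‖p‖ ^ 2 := by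
  set K := 2 * Real.pi * (r1 ^ 2 / 2 * Real.log r1 - r1 ^ 2 / 4) with hK
  refine ⟨(∫ y in Metric.ball (0:E2) r2, (-K + (-(Real.pi / 2)) * ‖y‖ ^ 2)) -
    ∫ x in Metric.ball (0:E2) r2, ∫ y in Metric.ball (0:E2) r2, Real.log (1 / ‖x - y‖), ?_⟩
  intro p hp
  have hsub : Metric.ball p r2 ⊆ Metric.ball (0:E2) r1 := by
    apply Metric.ball_subset_ball'
    rw [dist_zero_right]; linarith
  have hI : Integrable (fun z : E2 × E2 => Real.log (1 / ‖z.1 - z.2‖))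
      ((volume.restrict (Metric.ball 0 r1)).prod (volume.restrict (Metric.ball p r2))) := by
    rw [Measure.prod_restrict]
    have := (log_int_prod (E := E2) (by simp) r1).neg.mono_set
      (Set.prod_mono subset_rfl hsub)
    refine Integrable.congr this ?_
    filter_upwards with z
    simp
  rw [coreShellCross, setIntegral_sdiff measurableSet_ball hI.integral_prod_left hsub, self_int,
    integral_integral_swap hI]
  have : ∀ y ∈ Metric.ball p r2, ∫ x in Metric.ball (0:E2) r1, Real.log (1 / ‖x - y‖) =
      -K + (-(Real.pi / 2)) * ‖y‖ ^ 2 := by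
    intro y hy
    have hy' := hsub hy
    rw [mem_ball_zero_iff] at hy'
    simp only [one_div, Real.log_inv, integral_neg]
    rw [pot_eucl _ _ hy'.le, hK]; ring
  rw [setIntegral_congr_fun measurableSet_ball this, sq_int]
  ring

theorem coreShellCross_radial_strict_anti (r1 r2 : ℝ) (hr2 : 0 < r2) (hr12 : r2 < r1) :
    (∀ p q : EuclideanSpace ℝ (Fin 2), ‖p‖ ≤ r1 - r2 → ‖q‖ ≤ r1 - r2 → ‖p‖ = ‖q‖ →
      coreShellCross r1 r2 p = coreShellCross r1 r2 q) ∧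
    (∀ p q : EuclideanSpace ℝ (Fin 2), ‖p‖ < ‖q‖ → ‖q‖ ≤ r1 - r2 →
      coreShellCross r1 r2 q < coreShellCross r1 r2 p) ∧
    (∀ p : EuclideanSpace ℝ (Fin 2), ‖p‖ ≤ r1 - r2 →
      coreShellCross r1 r2 p ≤ coreShellCross r1 r2 0 ∧
      (coreShellCross r1 r2 p = coreShellCross r1 r2 0 → p = 0)) ∧
    (∀ p q : EuclideanSpace ℝ (Fin 2), ‖p‖ ≤ r1 - r2 → ‖q‖ = r1 - r2 →
      coreShellCross r1 r2 q ≤ coreShellCross r1 r2 p ∧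
      (coreShellCross r1 r2 p = coreShellCross r1 r2 q → ‖p‖ = r1 - r2)) := by
  obtain ⟨C, hC⟩ := cross_formula r1 r2
  have hv : 0 < volume.real (Metric.ball (0 : EuclideanSpace ℝ (Fin 2)) r2) :=
    ENNReal.toReal_pos (Metric.measure_ball_pos _ _ hr2).ne' measure_ball_lt_top.ne
  have hk : 0 < Real.pi / 2 * volume.real (Metric.ball (0 : EuclideanSpace ℝ (Fin 2)) r2) :=
    mul_pos (by positivity) hv
  have A : ∀ p q : EuclideanSpace ℝ (Fin 2), ‖p‖ ≤ r1 - r2 → ‖q‖ ≤ r1 - r2 → ‖p‖ = ‖q‖ →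
      coreShellCross r1 r2 p = coreShellCross r1 r2 q := by
    intro p q hp hq h
    rw [hC p hp, hC q hq, h]
  have B : ∀ p q : EuclideanSpace ℝ (Fin 2), ‖p‖ < ‖q‖ → ‖q‖ ≤ r1 - r2 →
      coreShellCross r1 r2 q < coreShellCross r1 r2 p := by
    intro p q h hq
    rw [hC p (h.le.trans hq), hC q hq]
    have : ‖p‖ ^ 2 < ‖q‖ ^ 2 := by gcongr
    have := mul_lt_mul_of_pos_left this hk
    linarith
  refine ⟨A, B, ?_, ?_⟩
  · intro p hp
    by_cases h : p = 0
    · subst h; simp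
    · have := B 0 p (by simpa using h) hp
      exact ⟨this.le, fun h' => absurd h' this.ne⟩
  · intro p q hp hq
    rcases hp.lt_or_eq with h | h
    · have := B p q (hq ▸ h) hq.le
      exact ⟨this.le, fun h' => absurd h' this.ne'⟩
    · exact ⟨(A p q hp hq.le (h.trans hq.symm)).ge, fun _ => h⟩
end

section
/- Let 0 < r2 < r1 and let Γ11, Γ12, Γ22 ≥ 0 with Γ11 > Γ12. For p ∈ ℝ² with ‖p‖ ≤ r1 − r2 set A1(p) := B_{r1}(0) \ B_{r2}(p), A2(p) := B_{r2}(p), and J(p) := Γ11·∫_{A1(p)}∫_{A1(p)} log(1/‖x−y‖) dy dx + 2·Γ12·∫_{A1(p)}∫_{A2(p)} log(1/‖x−y‖) dy dx + Γ22·∫_{A2(p)}∫_{A2(p)} log(1/‖x−y‖) dy dx. Then J(0) ≤ J(p) for every p with ‖p‖ ≤ r1 − r2, with strict inequality whenever p ≠ 0; that is, the interaction energy of a core shell is uniquely minimized by the concentric configuration. -/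
open MeasureTheory

/-- The logarithmic self-interaction energy `J(p)` of the (generalized) core shell with
outer annulus `A1(p) = B_{r1}(0) \ B_{r2}(p)` and inner disk `A2(p) = B_{r2}(p)`,
with interaction coefficients `Γij`. -/
noncomputable def coreShellInteraction (Γ11 Γ12 Γ22 r1 r2 : ℝ)
    (p : EuclideanSpace ℝ (Fin 2)) : ℝ :=
  Γ11 * (∫ x in Metric.ball (0 : EuclideanSpace ℝ (Fin 2)) r1 \ Metric.ball p r2,
      ∫ y in Metric.ball (0 : EuclideanSpace ℝ (Fin 2)) r1 \ Metric.ball p r2,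
        Real.log (1 / ‖x - y‖)) +
  2 * Γ12 * (∫ x in Metric.ball (0 : EuclideanSpace ℝ (Fin 2)) r1 \ Metric.ball p r2,
      ∫ y in Metric.ball p r2, Real.log (1 / ‖x - y‖)) +
  Γ22 * ∫ x in Metric.ball p r2, ∫ y in Metric.ball p r2, Real.log (1 / ‖x - y‖)

open Set Metric

lemma css_log_int {F : Type*} [NormedAddCommGroup F] [NormedSpace ℝ F] [MeasurableSpace F]
    [BorelSpace F] [FiniteDimensional ℝ F] (μ : Measure F) [μ.IsAddHaarMeasure]
    (hF : Module.finrank ℝ F = 2) (R : ℝ) :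
    IntegrableOn (fun x : F => Real.log ‖x‖) (ball 0 R) μ := by
  have : Nontrivial F := Module.nontrivial_of_finrank_pos (R := ℝ) (by omega)
  rw [integrableOn_fun_norm_addHaar, hF]
  have : IntegrableOn (fun y : ℝ => y * Real.log y) (Icc 0 R) :=
    Real.continuous_mul_log.continuousOn.integrableOn_Icc
  simpa using this.mono_set Ioo_subset_Icc_self

lemma css_ker_int {F : Type*} [NormedAddCommGroup F] [NormedSpace ℝ F] [MeasurableSpace F]
    [BorelSpace F] [FiniteDimensional ℝ F] (μ : Measure F) [μ.IsAddHaarMeasure]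
    (hF : Module.finrank ℝ F = 2) (R : ℝ) (x : F) :
    IntegrableOn (fun y : F => Real.log ‖x - y‖) (ball 0 R) μ := by
  have h1 := css_log_int μ hF (R + ‖x‖)
  rw [← integrable_indicator_iff measurableSet_ball] at h1
  have h2 := (h1.comp_sub_left x).integrableOn (s := ball 0 R)
  refine h2.congr_fun ?_ measurableSet_ball
  intro y hy
  have : x - y ∈ ball (0:F) (R + ‖x‖) := by
    simp at hy ⊢
    linarith [norm_sub_le x y]
  simp only [indicator_of_mem this]

lemma css_ker_prod_int {F : Type*} [NormedAddCommGroup F] [NormedSpace ℝ F] [MeasurableSpace F]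
    [BorelSpace F] [FiniteDimensional ℝ F] (μ : Measure F) [μ.IsAddHaarMeasure]
    (hF : Module.finrank ℝ F = 2) (R : ℝ) :
    IntegrableOn (fun p : F × F => Real.log ‖p.1 - p.2‖) (ball 0 R ×ˢ ball 0 R) (μ.prod μ) := by
  have h1 := css_log_int μ hF (R + R)
  rw [← integrable_indicator_iff measurableSet_ball] at h1
  have h0 : Integrable ((ball (0:F) R).indicator (fun _ => (1:ℝ))) μ := by
    rw [integrable_indicator_iff measurableSet_ball]
    exact integrableOn_const (by exact measure_ball_lt_top.ne)
  have h2 := (h0.convolution_integrand (ContinuousLinearMap.mul ℝ ℝ) h1).integrableOn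
    (s := ball 0 R ×ˢ ball 0 R)
  refine h2.congr_fun ?_ (measurableSet_ball.prod measurableSet_ball)
  rintro ⟨x, y⟩ ⟨hx, hy⟩
  have : x - y ∈ ball (0:F) (R + R) := by
    simp at hx hy ⊢
    linarith [norm_sub_le x y]
  simp only at hx hy
  simp [indicator_of_mem this, indicator_of_mem hy]

lemma css_polar (f : ℂ → ℝ) (hf : Integrable f) :
    ∫ z, f z = ∫ r in Ioi (0:ℝ), r * ((2 * Real.pi) * Real.circleAverage f 0 r) := by
  have hsymm : ∀ p : ℝ × ℝ, Complex.polarCoord.symm p =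
      Complex.measurableEquivRealProd.symm (polarCoord.symm p) := by
    intro p; rw [Complex.measurableEquivRealProd_symm_polarCoord_symm_apply]
  rw [← Complex.integral_comp_polarCoord_symm]
  have hg : Integrable (fun q : ℝ × ℝ => f (Complex.measurableEquivRealProd.symm q)) :=
    (Complex.volume_preserving_equiv_real_prod.symm _).integrable_comp_of_integrable hf
  have hI : IntegrableOn (fun p : ℝ × ℝ => p.1 • f (Complex.polarCoord.symm p))
      (Ioi (0:ℝ) ×ˢ Ioo (-Real.pi) Real.pi) := by
    have := (integrableOn_image_iff_integrableOn_abs_det_fderiv_smul (volume : Measure (ℝ × ℝ))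
      (polarCoord.open_target.measurableSet)
      (fun p _ ↦ (hasFDerivAt_polarCoord_symm p).hasFDerivWithinAt) polarCoord.symm.injOn
      (fun q : ℝ × ℝ => f (Complex.measurableEquivRealProd.symm q))).1 hg.integrableOn
    refine this.congr_fun ?_ polarCoord.open_target.measurableSet
    intro p hp
    simp only [hsymm, det_fderivPolarCoordSymm]
    rw [abs_of_pos hp.1]
  have key : polarCoord.target = Ioi (0:ℝ) ×ˢ Ioo (-Real.pi) Real.pi := rfl
  rw [key]
  rw [Measure.volume_eq_prod] at hI ⊢
  rw [setIntegral_prod _ hI]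
  refine setIntegral_congr_fun measurableSet_Ioi ?_
  intro r hr
  simp only [smul_eq_mul]
  rw [integral_const_mul]
  congr 1
  rw [Real.circleAverage_def, smul_eq_mul, ← mul_assoc, mul_inv_cancel₀ (by positivity), one_mul]
  rw [← integral_Ioc_eq_integral_Ioo, ← intervalIntegral.integral_of_le (by linarith [Real.pi_pos])]
  have hper : Function.Periodic (fun θ => f (circleMap 0 r θ)) (2 * Real.pi) := by
    intro θ; simp only [periodic_circleMap 0 r θ]
  have := hper.intervalIntegral_add_eq (-Real.pi) 0
  rw [show -Real.pi + 2 * Real.pi = Real.pi by ring, zero_add] at this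
  rw [← this]
  congr 1
  ext θ
  rw [Complex.polarCoord_symm_apply, circleMap, Complex.exp_mul_I]
  simp

lemma css_radial (R s : ℝ) (hs : 0 ≤ s) (hsR : s ≤ R) :
    ∫ r in Ioo (0:ℝ) R, r * (2 * Real.pi * (Real.log r + Real.posLog (r⁻¹ * s)))
      = 2 * Real.pi * (R ^ 2 / 2 * Real.log R - R ^ 2 / 4 + s ^ 2 / 4) := by
  have e : ∀ r ∈ Ioo (0:ℝ) R, r * (2 * Real.pi * (Real.log r + Real.posLog (r⁻¹ * s))) =
      2 * Real.pi * (if r ≤ s then r * Real.log s else r * Real.log r) := by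
    intro r hr
    split_ifs with h
    · have h1 : 1 ≤ |r⁻¹ * s| := by
        rw [abs_of_nonneg (by have := hr.1; positivity), inv_mul_eq_div, le_div_iff₀ hr.1]; linarith
      rw [Real.posLog_eq_log h1, Real.log_mul (inv_ne_zero hr.1.ne') (by linarith [hr.1]),
        Real.log_inv]
      ring
    · have : Real.posLog (r⁻¹ * s) = 0 := by
        rw [Real.posLog_eq_zero_iff, abs_of_nonneg (by have := hr.1; positivity), inv_mul_eq_div,
          div_le_iff₀ hr.1]; linarith
      rw [this]; ring
  rw [setIntegral_congr_fun measurableSet_Ioo e, integral_const_mul]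
  congr 1
  rw [← integral_Ioc_eq_integral_Ioo, ← intervalIntegral.integral_of_le (hs.trans hsR)]
  have c1 : EqOn (fun r => if r ≤ s then r * Real.log s else r * Real.log r)
      (fun r => r * Real.log s) (uIoc 0 s) := by
    intro r hr; rw [uIoc_of_le hs] at hr; simp [hr.2]
  have c2 : EqOn (fun r => if r ≤ s then r * Real.log s else r * Real.log r)
      (fun r => r * Real.log r) (uIoc s R) := by
    intro r hr; rw [uIoc_of_le hsR] at hr; simp [not_le.2 hr.1]
  have i1 : IntervalIntegrable (fun r => r * Real.log s) volume 0 s :=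
    (by fun_prop : Continuous (fun r => r * Real.log s)).intervalIntegrable _ _
  have i2 : IntervalIntegrable (fun r => r * Real.log r) volume s R :=
    Real.continuous_mul_log.intervalIntegrable _ _
  rw [← intervalIntegral.integral_add_adjacent_intervals (i1.congr c1.symm) (i2.congr c2.symm),
    intervalIntegral.integral_congr_ae (ae_of_all _ c1),
    intervalIntegral.integral_congr_ae (ae_of_all _ c2),
    intervalIntegral.integral_mul_const, integral_id]
  have : ∫ r in s..R, r * Real.log r =
      (R * (R * Real.log R) / 2 - R ^ 2 / 4) - (s * (s * Real.log s) / 2 - s ^ 2 / 4) := by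
    refine intervalIntegral.integral_eq_sub_of_hasDerivAt_of_le hsR
      (f := fun r => r * (r * Real.log r) / 2 - r ^ 2 / 4) ?_ ?_ i2
    · have := Real.continuous_mul_log
      exact (by fun_prop : Continuous fun r : ℝ => r * (r * Real.log r) / 2 - r ^ 2 / 4).continuousOn
    · intro r hr
      have hr0 : r ≠ 0 := by linarith [hr.1]
      have := ((((hasDerivAt_id r).mul ((hasDerivAt_id r).mul (Real.hasDerivAt_log hr0))).div_const 2).sub
        ((hasDerivAt_pow 2 r).div_const 4))
      convert! this using 1
      simp; field_simp; ring
  rw [this]; ring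

lemma css_pot_C (R : ℝ) (a : ℂ) (ha : ‖a‖ ≤ R) :
    ∫ z in ball (0:ℂ) R, Real.log ‖a - z‖ =
      2 * Real.pi * (R ^ 2 / 2 * Real.log R - R ^ 2 / 4 + ‖a‖ ^ 2 / 4) := by
  have hi := css_ker_int (volume : Measure ℂ) Complex.finrank_real_complex R a
  rw [← integral_indicator measurableSet_ball,
    css_polar _ ((integrable_indicator_iff measurableSet_ball).2 hi), ← css_radial R ‖a‖ (norm_nonneg a) ha,
    ← Ioi_inter_Iio, ← setIntegral_indicator measurableSet_Iio]
  refine setIntegral_congr_fun measurableSet_Ioi ?_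
  intro r hr
  have hr' : 0 < r := hr
  by_cases h : r < R
  · rw [indicator_of_mem (show r ∈ Iio R from h)]
    have := circleAverage_log_norm_sub_const_eq_log_radius_add_posLog (a := a) (c := 0) hr'.ne'
    simp only [zero_sub, norm_neg] at this
    simp only
    rw [← this]
    congr 2
    apply Real.circleAverage_congr_sphere
    intro z hz
    simp [abs_of_pos hr'] at hz
    simp only
    rw [indicator_of_mem (by simpa [hz] using h), norm_sub_rev]
  · rw [indicator_of_notMem (show r ∉ Iio R from h)]
    simp only
    have : Real.circleAverage ((ball 0 R).indicator fun z => Real.log ‖a - z‖) 0 r =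
        Real.circleAverage (fun _ => (0:ℝ)) 0 r := by
      apply Real.circleAverage_congr_sphere
      intro z hz
      simp [abs_of_pos hr'] at hz
      simp only
      rw [indicator_of_notMem (by simpa [hz] using h)]
    rw [this, Real.circleAverage_const]; simp

lemma css_pot (R : ℝ) (a : EuclideanSpace ℝ (Fin 2)) (ha : ‖a‖ ≤ R) :
    ∫ z in ball (0:EuclideanSpace ℝ (Fin 2)) R, Real.log ‖a - z‖ =
      2 * Real.pi * (R ^ 2 / 2 * Real.log R - R ^ 2 / 4 + ‖a‖ ^ 2 / 4) := by
  let e := Complex.orthonormalBasisOneI.repr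
  have h := css_pot_C R (e.symm a) (by simpa using ha)
  have hp := e.measurePreserving.setIntegral_preimage_emb e.toHomeomorph.measurableEmbedding
    (fun z => Real.log ‖a - z‖) (ball 0 R)
  rw [← hp]
  rw [LinearIsometryEquiv.norm_map] at h
  rw [← h]
  have : e ⁻¹' ball 0 R = ball 0 R := by ext; simp
  rw [this]
  congr 1; ext z
  rw [← e.symm.norm_map, map_sub, e.symm_apply_apply]

noncomputable abbrev cssI (S T : Set (EuclideanSpace ℝ (Fin 2))) : ℝ :=
  ∫ x in S, ∫ y in T, Real.log (1 / ‖x - y‖)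

lemma css_prod_int {R : ℝ} {S T : Set (EuclideanSpace ℝ (Fin 2))} (hS : S ⊆ ball 0 R)
    (hT : T ⊆ ball 0 R) :
    IntegrableOn (fun p : EuclideanSpace ℝ (Fin 2) × EuclideanSpace ℝ (Fin 2) =>
      Real.log (1 / ‖p.1 - p.2‖)) (S ×ˢ T) (volume.prod volume) := by
  have h := (css_ker_prod_int (volume : Measure (EuclideanSpace ℝ (Fin 2))) (by simp) R).neg
  refine IntegrableOn.mono_set ?_ (prod_mono hS hT)
  refine h.congr (ae_of_all _ fun p => ?_)
  simp [Real.log_inv]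

lemma cssI_eq {R : ℝ} {S T : Set (EuclideanSpace ℝ (Fin 2))} (hS : S ⊆ ball 0 R)
    (hT : T ⊆ ball 0 R) :
    cssI S T = ∫ p in S ×ˢ T, Real.log (1 / ‖p.1 - p.2‖) ∂(volume.prod volume) :=
  (setIntegral_prod _ (css_prod_int hS hT)).symm

lemma cssI_symm {R : ℝ} {S T : Set (EuclideanSpace ℝ (Fin 2))} (hS : S ⊆ ball 0 R)
    (hT : T ⊆ ball 0 R) : cssI S T = cssI T S := by
  rw [cssI_eq hS hT, cssI_eq hT hS, ← setIntegral_prod_swap]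
  congr 1; ext p
  simp [norm_sub_rev]

lemma cssI_diff {R : ℝ} {B D T : Set (EuclideanSpace ℝ (Fin 2))} (hB : B ⊆ ball 0 R)
    (hT : T ⊆ ball 0 R) (hDB : D ⊆ B) (hDm : MeasurableSet D) (hTm : MeasurableSet T) :
    cssI (B \ D) T = cssI B T - cssI D T := by
  rw [cssI_eq (sdiff_subset.trans hB) hT, cssI_eq hB hT, cssI_eq (hDB.trans hB) hT,
    ← setIntegral_sdiff (hDm.prod hTm) (css_prod_int hB hT) (prod_mono hDB le_rfl)]
  congr 2
  ext p; simp; tauto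

lemma css_translate (f : EuclideanSpace ℝ (Fin 2) → ℝ) (p : EuclideanSpace ℝ (Fin 2)) (r : ℝ) :
    ∫ x in ball p r, f x = ∫ x in ball 0 r, f (x + p) := by
  have hp := (measurePreserving_add_right (volume : Measure (EuclideanSpace ℝ (Fin 2))) p).setIntegral_preimage_emb
    (measurableEmbedding_addRight p) f (ball p r)
  rw [← hp]
  congr 2
  ext x; simp [dist_eq_norm]

lemma cssI_self (p : EuclideanSpace ℝ (Fin 2)) (r : ℝ) :
    cssI (ball p r) (ball p r) = cssI (ball 0 r) (ball 0 r) := by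
  unfold cssI
  rw [css_translate]
  congr 1; ext x
  rw [css_translate]
  simp

lemma css_sq (p : EuclideanSpace ℝ (Fin 2)) (r : ℝ) :
    ∫ x in ball p r, ‖x‖ ^ 2 =
      (∫ x in ball (0 : EuclideanSpace ℝ (Fin 2)) r, ‖x‖ ^ 2) +
        ‖p‖ ^ 2 * volume.real (ball (0 : EuclideanSpace ℝ (Fin 2)) r) := by
  have hint : ∀ f : EuclideanSpace ℝ (Fin 2) → ℝ, Continuous f → IntegrableOn f (ball 0 r) := by
    intro f hf
    exact (hf.continuousOn.integrableOn_compact (isCompact_closedBall 0 r)).mono_set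
      ball_subset_closedBall
  rw [css_translate]
  have h1 : ∫ x in ball (0 : EuclideanSpace ℝ (Fin 2)) r, ‖x + p‖ ^ 2 =
      ∫ x in ball (0 : EuclideanSpace ℝ (Fin 2)) r, ‖x - p‖ ^ 2 := by
    have hp := (Measure.measurePreserving_neg (volume : Measure (EuclideanSpace ℝ (Fin 2)))).setIntegral_preimage_emb
      (Homeomorph.neg _).measurableEmbedding (fun x => ‖x + p‖ ^ 2) (ball 0 r)
    rw [← hp]
    have : (Neg.neg : EuclideanSpace ℝ (Fin 2) → _) ⁻¹' ball 0 r = ball 0 r := by ext; simp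
    rw [this]
    congr 1; ext x
    rw [← norm_neg]; congr 2; abel
  have h2 : (∫ x in ball (0 : EuclideanSpace ℝ (Fin 2)) r, ‖x + p‖ ^ 2) +
      (∫ x in ball (0 : EuclideanSpace ℝ (Fin 2)) r, ‖x - p‖ ^ 2) =
      2 * ∫ x in ball (0 : EuclideanSpace ℝ (Fin 2)) r, (‖x‖ ^ 2 + ‖p‖ ^ 2) := by
    rw [← integral_add (hint _ (by fun_prop)) (hint _ (by fun_prop)), ← integral_const_mul]
    congr 1; ext x
    have := parallelogram_law_with_norm ℝ x p
    linarith
  rw [integral_add (hint _ (by fun_prop)) (hint _ (by fun_prop)), setIntegral_const] at h2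
  rw [smul_eq_mul] at h2
  linarith

lemma css_cross (r1 r2 : ℝ) (p : EuclideanSpace ℝ (Fin 2)) (hsub : ball p r2 ⊆ ball 0 r1) :
    cssI (ball p r2) (ball 0 r1) =
      -(2 * Real.pi * (r1 ^ 2 / 2 * Real.log r1 - r1 ^ 2 / 4)) *
          volume.real (ball (0 : EuclideanSpace ℝ (Fin 2)) r2)
        - Real.pi / 2 * ∫ x in ball p r2, ‖x‖ ^ 2 := by
  have hi : IntegrableOn (fun x : EuclideanSpace ℝ (Fin 2) => Real.pi / 2 * ‖x‖ ^ 2) (ball p r2) :=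
    ((by fun_prop : Continuous (fun x : EuclideanSpace ℝ (Fin 2) =>
      Real.pi / 2 * ‖x‖ ^ 2)).continuousOn.integrableOn_compact (isCompact_closedBall p r2)).mono_set
      ball_subset_closedBall
  have hv : volume.real (ball p r2) = volume.real (ball (0 : EuclideanSpace ℝ (Fin 2)) r2) := by
    simp only [Measure.real, Measure.addHaar_ball_center]
  have hc : IntegrableOn (fun _ : EuclideanSpace ℝ (Fin 2) =>
      -(2 * Real.pi * (r1 ^ 2 / 2 * Real.log r1 - r1 ^ 2 / 4))) (ball p r2) :=
    integrableOn_const (by exact measure_ball_lt_top.ne)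
  have e : cssI (ball p r2) (ball 0 r1) = ∫ x in ball p r2,
      (-(2 * Real.pi * (r1 ^ 2 / 2 * Real.log r1 - r1 ^ 2 / 4)) - Real.pi / 2 * ‖x‖ ^ 2) := by
    refine setIntegral_congr_fun measurableSet_ball ?_
    intro x hx
    have hx' : ‖x‖ ≤ r1 := by have := hsub hx; simp at this; exact this.le
    simp only [one_div, Real.log_inv]
    rw [integral_neg, css_pot r1 x hx']
    ring
  rw [e, integral_sub hc hi, setIntegral_const, integral_const_mul, hv, smul_eq_mul]
  ring

lemma css_energy (Γ11 Γ12 Γ22 r1 r2 : ℝ) (p : EuclideanSpace ℝ (Fin 2))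
    (hsub : ball p r2 ⊆ ball 0 r1) :
    coreShellInteraction Γ11 Γ12 Γ22 r1 r2 p =
      Γ11 * cssI (ball 0 r1) (ball 0 r1) - 2 * (Γ11 - Γ12) * cssI (ball p r2) (ball 0 r1)
        + (Γ11 - 2 * Γ12 + Γ22) * cssI (ball 0 r2) (ball 0 r2) := by
  have e : coreShellInteraction Γ11 Γ12 Γ22 r1 r2 p =
      Γ11 * cssI (ball 0 r1 \ ball p r2) (ball 0 r1 \ ball p r2) +
      2 * Γ12 * cssI (ball 0 r1 \ ball p r2) (ball p r2) +
      Γ22 * cssI (ball p r2) (ball p r2) := rfl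
  have hB : ball (0 : EuclideanSpace ℝ (Fin 2)) r1 ⊆ ball 0 r1 := le_rfl
  have hA : ball (0 : EuclideanSpace ℝ (Fin 2)) r1 \ ball p r2 ⊆ ball 0 r1 := sdiff_subset
  rw [e, cssI_diff hB hA hsub measurableSet_ball (measurableSet_ball.diff measurableSet_ball),
    cssI_diff hB hsub hsub measurableSet_ball measurableSet_ball,
    cssI_symm hB hA, cssI_symm hsub hA,
    cssI_diff hB hB hsub measurableSet_ball measurableSet_ball,
    cssI_diff hB hsub hsub measurableSet_ball measurableSet_ball,
    cssI_symm hB hsub, cssI_self p r2]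
  ring

/-- when `Γ11 > Γ12`, the core shell interaction energy is uniquely
minimized by the concentric configuration `p = 0`. -/
theorem coreShellInteraction_min_concentric (Γ11 Γ12 Γ22 r1 r2 : ℝ)
    (hr2 : 0 < r2) (hr12 : r2 < r1)
    (hΓ11 : 0 ≤ Γ11) (hΓ12 : 0 ≤ Γ12) (hΓ22 : 0 ≤ Γ22) (h : Γ12 < Γ11) :
    ∀ p : EuclideanSpace ℝ (Fin 2), ‖p‖ ≤ r1 - r2 →
      coreShellInteraction Γ11 Γ12 Γ22 r1 r2 0 ≤ coreShellInteraction Γ11 Γ12 Γ22 r1 r2 p ∧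
      (p ≠ 0 →
        coreShellInteraction Γ11 Γ12 Γ22 r1 r2 0 < coreShellInteraction Γ11 Γ12 Γ22 r1 r2 p) := by
  intro p hp
  have hs : ball p r2 ⊆ ball 0 r1 := ball_subset_ball' (by simpa using (by linarith : r2 + ‖p‖ ≤ r1))
  have hs0 : ball (0 : EuclideanSpace ℝ (Fin 2)) r2 ⊆ ball 0 r1 := ball_subset_ball hr12.le
  have hv : 0 < volume.real (ball (0 : EuclideanSpace ℝ (Fin 2)) r2) :=
    ENNReal.toReal_pos (measure_ball_pos _ _ hr2).ne' measure_ball_lt_top.ne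
  have hd : coreShellInteraction Γ11 Γ12 Γ22 r1 r2 p - coreShellInteraction Γ11 Γ12 Γ22 r1 r2 0 =
      (Γ11 - Γ12) * (Real.pi * volume.real (ball (0 : EuclideanSpace ℝ (Fin 2)) r2)) *
        ‖p‖ ^ 2 := by
    rw [css_energy _ _ _ _ _ p hs, css_energy _ _ _ _ _ 0 hs0, css_cross _ _ p hs,
      css_cross _ _ 0 hs0, css_sq p]
    ring
  have hc : 0 < (Γ11 - Γ12) * (Real.pi * volume.real (ball (0 : EuclideanSpace ℝ (Fin 2)) r2)) :=
    mul_pos (by linarith) (mul_pos Real.pi_pos hv)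
  constructor
  · have := mul_nonneg hc.le (sq_nonneg ‖p‖)
    linarith
  · intro hp0
    have := mul_pos hc (pow_pos (norm_pos_iff.2 hp0) 2)
    linarith
end

section
/- Let 0 < r2 < r1 and let Γ11, Γ12, Γ22 ≥ 0 with Γ12 > Γ11. For p ∈ ℝ² with ‖p‖ ≤ r1 − r2 set A1(p) := B_{r1}(0) \ B_{r2}(p), A2(p) := B_{r2}(p), and J(p) := Γ11·∫_{A1(p)}∫_{A1(p)} log(1/‖x−y‖) dy dx + 2·Γ12·∫_{A1(p)}∫_{A2(p)} log(1/‖x−y‖) dy dx + Γ22·∫_{A2(p)}∫_{A2(p)} log(1/‖x−y‖) dy dx. Then for every q with ‖q‖ = r1 − r2 and every p with ‖p‖ ≤ r1 − r2 one has J(q) ≤ J(p), with strict inequality whenever ‖p‖ < r1 − r2; that is, the interaction energy of a core shell is minimized exactly by the tangential configurations, in which the inner circle is tangent to the outer circle. -/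
open MeasureTheory

section gen
variable {V : Type*} [NormedAddCommGroup V] [InnerProductSpace ℝ V] [MeasurableSpace V]
  [BorelSpace V] [FiniteDimensional ℝ V]

theorem cs_L1 (hd : Module.finrank ℝ V = 2) (R : ℝ) :
    IntegrableOn (fun z : V => Real.log (1 / ‖z‖)) (Metric.ball 0 R) := by
  have : Nontrivial V := Module.nontrivial_of_finrank_pos (R := ℝ) (by omega)
  rw [integrableOn_fun_norm_addHaar (μ := (volume : Measure V)) (f := fun r => Real.log (1 / r)), hd]
  have : Continuous (fun y : ℝ => y ^ (2 - 1) • Real.log (1 / y)) := by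
    have h := Real.continuous_mul_log.neg
    refine h.congr fun x => ?_
    simp
  exact (this.integrableOn_Icc (a := 0) (b := R)).mono_set Set.Ioo_subset_Icc_self

theorem cs_L1' (hd : Module.finrank ℝ V = 2) (R : ℝ) (x : V) :
    IntegrableOn (fun y : V => Real.log (1 / ‖x - y‖)) (Metric.ball 0 R) := by
  have h := (integrable_indicator_iff measurableSet_ball).2 (cs_L1 (V := V) hd (R + ‖x‖))
  have h2 := h.comp_sub_left x
  refine (h2.integrableOn (s := Metric.ball 0 R)).congr_fun ?_ measurableSet_ball
  intro y hy
  have : x - y ∈ Metric.ball (0 : V) (R + ‖x‖) := by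
    rw [mem_ball_zero_iff] at *
    have := norm_sub_le x y
    linarith
  simp [Set.indicator_of_mem this]

theorem cs_L2 (hd : Module.finrank ℝ V = 2) (R : ℝ) :
    Integrable (Function.uncurry fun x y : V => Real.log (1 / ‖x - y‖))
      ((volume.restrict (Metric.ball 0 R)).prod (volume.restrict (Metric.ball 0 R))) := by
  have h := (integrable_indicator_iff measurableSet_ball).2 (cs_L1 (V := V) hd (R + R))
  have h1 : Integrable ((Metric.ball (0:V) R).indicator fun _ => (1:ℝ)) :=
    (integrable_indicator_iff measurableSet_ball).2 (integrableOn_const (by exact measure_ball_lt_top.ne))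
  have h2 := h1.convolution_integrand (ContinuousLinearMap.mul ℝ ℝ) h
  rw [Measure.prod_restrict]
  refine (h2.integrableOn (s := Metric.ball 0 R ×ˢ Metric.ball 0 R)).congr_fun ?_
    (measurableSet_ball.prod measurableSet_ball)
  rintro ⟨x, y⟩ ⟨hx, hy⟩
  simp only at hx hy
  have : x - y ∈ Metric.ball (0 : V) (R + R) := by
    rw [mem_ball_zero_iff] at *
    have := norm_sub_le x y
    linarith
  simp [Set.indicator_of_mem this, Set.indicator_of_mem hy]

theorem cs_radial (hd : Module.finrank ℝ V = 2) {a R : ℝ} (ha : 0 < a) (haR : a ≤ R) :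
    ∫ y : V in Metric.ball 0 R, (Real.log a + Real.posLog (a⁻¹ * ‖y‖)) =
      2 * (volume.real (Metric.ball (0:V) 1)) * (R ^ 2 / 2 * Real.log R - R ^ 2 / 4 + a ^ 2 / 4) := by
  have : Nontrivial V := Module.nontrivial_of_finrank_pos (R := ℝ) (by omega)
  rw [← integral_indicator measurableSet_ball]
  have h := integral_fun_norm_addHaar (volume : Measure V)
    ((Set.Iio R).indicator fun s => Real.log a + Real.posLog (a⁻¹ * s))
  have e : (Metric.ball (0:V) R).indicator (fun y => Real.log a + Real.posLog (a⁻¹ * ‖y‖)) =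
     fun y => ((Set.Iio R).indicator fun s => Real.log a + Real.posLog (a⁻¹ * s)) ‖y‖ := by
    ext y; simp [Set.indicator]
  rw [e, h, hd]
  simp only [nsmul_eq_mul, smul_eq_mul, Nat.cast_ofNat, mul_assoc]
  congr 2
  have e2 : ∀ y ∈ Set.Ioi (0:ℝ), y ^ (2 - 1) * (Set.Iio R).indicator (fun s => Real.log a + Real.posLog (a⁻¹ * s)) y
     = (Set.Iio R).indicator (fun s => s * (Real.log a + Real.posLog (a⁻¹ * s))) y := by
    intro y _
    by_cases hy : y < R <;> simp [hy]
  rw [setIntegral_congr_fun measurableSet_Ioi e2, setIntegral_indicator measurableSet_Iio,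
    Set.Ioi_inter_Iio, ← integral_Ioc_eq_integral_Ioo, ← intervalIntegral.integral_of_le (by linarith)]
  have hc : Continuous fun s : ℝ => s * (Real.log a + Real.posLog (a⁻¹ * s)) := by
    have := Real.continuous_posLog
    fun_prop
  rw [← intervalIntegral.integral_add_adjacent_intervals (b := a) (hc.intervalIntegrable _ _) (hc.intervalIntegrable _ _)]
  have i1 : ∫ s in (0:ℝ)..a, s * (Real.log a + Real.posLog (a⁻¹ * s)) = ∫ s in (0:ℝ)..a, s * Real.log a := by
    refine intervalIntegral.integral_congr fun s hs => ?_
    rw [Set.uIcc_of_le ha.le] at hs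
    have : Real.posLog (a⁻¹ * s) = 0 := by
      rw [Real.posLog_eq_zero_iff, abs_of_nonneg (by have := hs.1; positivity), inv_mul_le_iff₀ ha]
      linarith [hs.2]
    simp [this]
  have i2 : ∫ s in a..R, s * (Real.log a + Real.posLog (a⁻¹ * s)) = ∫ s in a..R, s * Real.log s := by
    refine intervalIntegral.integral_congr fun s hs => ?_
    rw [Set.uIcc_of_le haR] at hs
    have hs0 : 0 < s := ha.trans_le hs.1
    have : Real.posLog (a⁻¹ * s) = Real.log (a⁻¹ * s) := by
      refine Real.posLog_eq_log ?_
      rw [abs_of_nonneg (by positivity), le_inv_mul_iff₀ ha]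
      linarith [hs.1]
    simp only [this]
    rw [Real.log_mul (by positivity) (by positivity), Real.log_inv]
    ring
  have i3 : ∫ s in a..R, s * Real.log s = (R ^ 2 / 2 * Real.log R - R ^ 2 / 4) - (a ^ 2 / 2 * Real.log a - a ^ 2 / 4) := by
    refine intervalIntegral.integral_eq_sub_of_hasDerivAt (f := fun s => s ^ 2 / 2 * Real.log s - s ^ 2 / 4) ?_ (Real.continuous_mul_log.intervalIntegrable _ _)
    intro s hs
    rw [Set.uIcc_of_le haR] at hs
    have hs0 : s ≠ 0 := (ha.trans_le hs.1).ne'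
    have := (((hasDerivAt_pow 2 s).div_const 2).mul (Real.hasDerivAt_log hs0)).sub ((hasDerivAt_pow 2 s).div_const 4)
    have e3 : s * Real.log s = ((2:ℕ):ℝ) * s ^ (2 - 1) / 2 * Real.log s + s ^ 2 / 2 * s⁻¹ - ((2:ℕ):ℝ) * s ^ (2 - 1) / 4 := by
      norm_num
      field_simp
      ring
    rw [e3]
    exact this
  rw [i1, i2, i3, intervalIntegral.integral_mul_const, integral_id]
  ring

theorem cs_sq (p : V) (r : ℝ) :
    ∫ x in Metric.ball p r, ‖x‖ ^ 2 =
      ‖p‖ ^ 2 * volume.real (Metric.ball (0:V) r) + ∫ x in Metric.ball (0:V) r, ‖x‖ ^ 2 := by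
  have io : ∀ f : V → ℝ, Continuous f → IntegrableOn f (Metric.ball (0:V) r) := fun f hf =>
    (hf.continuousOn.integrableOn_compact (isCompact_closedBall (0:V) r)).mono_set Metric.ball_subset_closedBall
  have h1 : ∫ x in Metric.ball p r, ‖x‖ ^ 2 = ∫ x in Metric.ball (0:V) r, ‖p + x‖ ^ 2 := by
    have := (measurePreserving_add_left (volume : Measure V) p).setIntegral_preimage_emb
      (measurableEmbedding_addLeft p) (fun x => ‖x‖ ^ 2) (Metric.ball p r)
    rw [← this]
    simp
  have h2 : ∫ x in Metric.ball (0:V) r, inner ℝ p x = 0 := by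
    have := (Measure.measurePreserving_neg (volume : Measure V)).setIntegral_preimage_emb
      (Homeomorph.neg V).measurableEmbedding (fun x => inner ℝ p x) (Metric.ball 0 r)
    simp [integral_neg] at this
    linarith
  rw [h1]
  simp_rw [norm_add_sq_real]
  rw [integral_add (io _ (by fun_prop)) (io _ (by fun_prop)),
    integral_add (io _ (by fun_prop)) (io _ (by fun_prop)), integral_const_mul, h2]
  simp [mul_comm]

theorem cs_self (p : V) (r : ℝ) :
    ∫ x in Metric.ball p r, ∫ y in Metric.ball p r, Real.log (1 / ‖x - y‖) =
     ∫ x in Metric.ball (0:V) r, ∫ y in Metric.ball (0:V) r, Real.log (1 / ‖x - y‖) := by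
  have key : ∀ f : V → ℝ, ∫ x in Metric.ball p r, f x = ∫ x in Metric.ball (0:V) r, f (p + x) := by
    intro f
    have := (measurePreserving_add_left (volume : Measure V) p).setIntegral_preimage_emb
      (measurableEmbedding_addLeft p) f (Metric.ball p r)
    rw [← this]
    simp
  rw [key]
  refine integral_congr_ae (Filter.Eventually.of_forall fun x => ?_)
  simp only [key]
  simp
end gen

theorem cs_rot (R : ℝ) (g : ℝ → ℝ) (c : ℂ) (hc : ‖c‖ = 1) (x : ℂ) :
    ∫ y in Metric.ball (0:ℂ) R, g ‖c * x - y‖ = ∫ y in Metric.ball (0:ℂ) R, g ‖x - y‖ := by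
  let e := rotation ⟨c, by simp [Submonoid.unitSphere, hc]⟩
  have := (e.measurePreserving).setIntegral_preimage_emb
      e.toHomeomorph.measurableEmbedding (fun y => g ‖c * x - y‖) (Metric.ball 0 R)
  rw [← this]
  have e1 : e ⁻¹' Metric.ball 0 R = Metric.ball 0 R := by
    ext y; simp
  rw [e1]
  refine integral_congr_ae (Filter.Eventually.of_forall fun y => ?_)
  simp only
  congr 1
  have : c * x - e y = c * (x - y) := by
    have : e y = c * y := rotation_apply _ _
    rw [this]; ring
  rw [this, norm_mul, hc, one_mul]

theorem cs_pot {x : ℂ} {R : ℝ} (hx : x ≠ 0) (hxR : ‖x‖ ≤ R) :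
    ∫ y in Metric.ball (0:ℂ) R, Real.log ‖x - y‖ =
      2 * (volume.real (Metric.ball (0:ℂ) 1)) * (R ^ 2 / 2 * Real.log R - R ^ 2 / 4 + ‖x‖ ^ 2 / 4) := by
  have ha : 0 < ‖x‖ := norm_pos_iff.2 hx
  rw [← cs_radial Complex.finrank_real_complex ha hxR]
  have rot : ∀ (g : ℝ → ℝ) θ, ∫ y in Metric.ball (0:ℂ) R, g ‖circleMap 0 ‖x‖ θ - y‖ = ∫ y in Metric.ball (0:ℂ) R, g ‖x - y‖ := by
    intro g θ
    have : circleMap 0 ‖x‖ θ = (circleMap 0 ‖x‖ θ / x) * x := by field_simp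
    rw [this]
    apply cs_rot
    simp [ha.ne']
  have hint : Integrable (Function.uncurry fun (θ : ℝ) (y : ℂ) => Real.log ‖circleMap 0 ‖x‖ θ - y‖)
    ((volume.restrict (Set.uIoc 0 (2 * Real.pi))).prod (volume.restrict (Metric.ball 0 R))) := by
    rw [integrable_prod_iff]
    · constructor
      · refine Filter.Eventually.of_forall fun θ => ?_
        have := (cs_L1' Complex.finrank_real_complex R (circleMap 0 ‖x‖ θ)).neg
        refine this.congr (Filter.Eventually.of_forall fun y => ?_)
        simp
      · simp only [Function.uncurry]
        have := rot (fun r => ‖Real.log r‖)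
        simp_rw [this]
        exact integrableOn_const (by rw [Set.uIoc, Real.volume_Ioc]; exact ENNReal.ofReal_ne_top)
    · refine Measurable.aestronglyMeasurable ?_
      have : Continuous fun q : ℝ × ℂ => circleMap 0 ‖x‖ q.1 - q.2 := by
        have := continuous_circleMap 0 ‖x‖
        fun_prop
      exact Real.measurable_log.comp (this.norm.measurable)
  have sw := intervalIntegral_integral_swap hint
  simp_rw [rot] at sw
  have avg : ∀ y : ℂ, ∫ θ in (0:ℝ)..(2 * Real.pi), Real.log ‖circleMap 0 ‖x‖ θ - y‖ =
      (2 * Real.pi) * (Real.log ‖x‖ + Real.posLog (‖x‖⁻¹ * ‖y‖)) := by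
    intro y
    have := circleAverage_log_norm_sub_const_eq_log_radius_add_posLog (c := 0) (a := y) ha.ne'
    rw [Real.circleAverage_def] at this
    simp only [zero_sub, norm_neg, smul_eq_mul] at this
    rw [← this]
    field_simp
  simp_rw [avg] at sw
  rw [integral_const_mul] at sw
  simp only [intervalIntegral.integral_const, smul_eq_mul, sub_zero] at sw
  exact mul_left_cancel₀ (by positivity) sw

theorem cs_potE {x : EuclideanSpace ℝ (Fin 2)} {R : ℝ} (hx : x ≠ 0) (hxR : ‖x‖ ≤ R) :
    ∫ y in Metric.ball (0:EuclideanSpace ℝ (Fin 2)) R, Real.log (1 / ‖x - y‖) =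
      - (2 * (volume.real (Metric.ball (0:ℂ) 1)) * (R ^ 2 / 2 * Real.log R - R ^ 2 / 4 + ‖x‖ ^ 2 / 4)) := by
  let e := Complex.orthonormalBasisOneI.repr
  have := (e.measurePreserving).setIntegral_preimage_emb
      e.toHomeomorph.measurableEmbedding (fun y => Real.log (1 / ‖x - y‖)) (Metric.ball 0 R)
  rw [← this]
  have e1 : e ⁻¹' Metric.ball 0 R = Metric.ball 0 R := by
    ext y; simp
  have hn : ‖e.symm x‖ = ‖x‖ := e.symm.norm_map x
  have h2 := cs_pot (x := e.symm x) (R := R) (by simpa using hx) (by rw [hn]; exact hxR)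
  rw [e1, ← hn, ← h2, ← integral_neg]
  refine integral_congr_ae (Filter.Eventually.of_forall fun y => ?_)
  have : ‖x - e y‖ = ‖e.symm x - y‖ := by
    rw [← e.norm_map (e.symm x - y)]; simp
  simp only [this]
  simp

theorem cs_J (Γ11 Γ12 Γ22 r1 r2 : ℝ) (hr2 : 0 < r2) (p : EuclideanSpace ℝ (Fin 2))
    (hp : ‖p‖ ≤ r1 - r2) :
    coreShellInteraction Γ11 Γ12 Γ22 r1 r2 p =
      Γ11 * (∫ x in Metric.ball (0 : EuclideanSpace ℝ (Fin 2)) r1,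
        ∫ y in Metric.ball (0 : EuclideanSpace ℝ (Fin 2)) r1, Real.log (1 / ‖x - y‖)) +
      (Γ11 - 2 * Γ12 + Γ22) * (∫ x in Metric.ball (0 : EuclideanSpace ℝ (Fin 2)) r2,
        ∫ y in Metric.ball (0 : EuclideanSpace ℝ (Fin 2)) r2, Real.log (1 / ‖x - y‖)) +
      2 * (Γ12 - Γ11) * ∫ x in Metric.ball p r2,
        ∫ y in Metric.ball (0 : EuclideanSpace ℝ (Fin 2)) r1, Real.log (1 / ‖x - y‖) := by
  have hd : Module.finrank ℝ (EuclideanSpace ℝ (Fin 2)) = 2 := by simp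
  have hsub : Metric.ball p r2 ⊆ Metric.ball (0 : EuclideanSpace ℝ (Fin 2)) r1 := by
    apply Metric.ball_subset_ball'
    rw [dist_zero_right]; linarith
  have mD : MeasurableSet (Metric.ball p r2) := measurableSet_ball
  unfold coreShellInteraction
  rw [cs_self p r2] at *
  have hprod := cs_L2 hd r1
  have hprodD : Integrable (Function.uncurry fun x y : EuclideanSpace ℝ (Fin 2) => Real.log (1 / ‖x - y‖))
      ((volume.restrict (Metric.ball 0 r1)).prod (volume.restrict (Metric.ball p r2))) := by
    refine hprod.mono_measure ?_
    exact Measure.prod_mono le_rfl (Measure.restrict_mono hsub le_rfl)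
  have iB : IntegrableOn (fun x => ∫ y in Metric.ball (0 : EuclideanSpace ℝ (Fin 2)) r1, Real.log (1 / ‖x - y‖)) (Metric.ball 0 r1) :=
    hprod.integral_prod_left
  have iD : IntegrableOn (fun x => ∫ y in Metric.ball p r2, Real.log (1 / ‖x - y‖)) (Metric.ball 0 r1) :=
    hprodD.integral_prod_left
  have inner : ∀ x : EuclideanSpace ℝ (Fin 2),
      ∫ y in Metric.ball (0 : EuclideanSpace ℝ (Fin 2)) r1 \ Metric.ball p r2, Real.log (1 / ‖x - y‖) =
      (∫ y in Metric.ball (0 : EuclideanSpace ℝ (Fin 2)) r1, Real.log (1 / ‖x - y‖)) -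
      ∫ y in Metric.ball p r2, Real.log (1 / ‖x - y‖) := fun x =>
    setIntegral_sdiff mD (cs_L1' hd r1 x) hsub
  have swap : ∫ x in Metric.ball (0 : EuclideanSpace ℝ (Fin 2)) r1, ∫ y in Metric.ball p r2, Real.log (1 / ‖x - y‖)
      = ∫ x in Metric.ball p r2, ∫ y in Metric.ball (0 : EuclideanSpace ℝ (Fin 2)) r1, Real.log (1 / ‖x - y‖) := by
    rw [integral_integral_swap hprodD]
    simp_rw [norm_sub_rev]
  simp_rw [inner]
  rw [integral_sub (iB.mono_set Set.diff_subset) (iD.mono_set Set.diff_subset),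
    setIntegral_sdiff mD iB hsub, setIntegral_sdiff mD iD hsub, swap, cs_self p r2]
  ring

theorem cs_cross {r1 r2 : ℝ} (p : EuclideanSpace ℝ (Fin 2)) (hp : ‖p‖ ≤ r1 - r2) :
    ∫ x in Metric.ball p r2,
        ∫ y in Metric.ball (0 : EuclideanSpace ℝ (Fin 2)) r1, Real.log (1 / ‖x - y‖) =
    - (2 * (volume.real (Metric.ball (0:ℂ) 1)) * ((r1 ^ 2 / 2 * Real.log r1 - r1 ^ 2 / 4) *
        volume.real (Metric.ball (0 : EuclideanSpace ℝ (Fin 2)) r2) +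
      (‖p‖ ^ 2 * volume.real (Metric.ball (0 : EuclideanSpace ℝ (Fin 2)) r2) +
       ∫ x in Metric.ball (0 : EuclideanSpace ℝ (Fin 2)) r2, ‖x‖ ^ 2) / 4)) := by
  have hae : ∀ᵐ x : EuclideanSpace ℝ (Fin 2), x ∈ Metric.ball p r2 →
      ∫ y in Metric.ball (0 : EuclideanSpace ℝ (Fin 2)) r1, Real.log (1 / ‖x - y‖) =
      - (2 * (volume.real (Metric.ball (0:ℂ) 1)) * (r1 ^ 2 / 2 * Real.log r1 - r1 ^ 2 / 4 + ‖x‖ ^ 2 / 4)) := by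
    filter_upwards [Measure.ae_ne volume (0 : EuclideanSpace ℝ (Fin 2))] with x hx hxp
    refine cs_potE hx ?_
    rw [mem_ball_iff_norm] at hxp
    have := norm_add_le (x - p) p
    rw [sub_add_cancel] at this
    linarith
  have fin : IsFiniteMeasure ((volume : Measure (EuclideanSpace ℝ (Fin 2))).restrict (Metric.ball p r2)) :=
    isFiniteMeasure_restrict.2 measure_ball_lt_top.ne
  rw [setIntegral_congr_ae measurableSet_ball hae, integral_neg, integral_const_mul, ← cs_sq p r2,
    integral_add (integrable_const _), integral_div, setIntegral_const]
  · have : volume.real (Metric.ball p r2) = volume.real (Metric.ball (0 : EuclideanSpace ℝ (Fin 2)) r2) := by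
      simp only [Measure.real, Measure.addHaar_ball_center]
    rw [this, smul_eq_mul]
    ring
  · have hf : Continuous fun x : EuclideanSpace ℝ (Fin 2) => ‖x‖ ^ 2 / 4 := by fun_prop
    exact (hf.continuousOn.integrableOn_compact (isCompact_closedBall p r2)).mono_set Metric.ball_subset_closedBall

/-- when `Γ12 > Γ11`, the core shell interaction energy is minimized
exactly by the tangential configurations, with `‖p‖ = r1 − r2`. -/
theorem coreShellInteraction_min_tangential (Γ11 Γ12 Γ22 r1 r2 : ℝ)
    (hr2 : 0 < r2) (hr12 : r2 < r1)
    (hΓ11 : 0 ≤ Γ11) (hΓ12 : 0 ≤ Γ12) (hΓ22 : 0 ≤ Γ22) (h : Γ11 < Γ12) :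
    ∀ q p : EuclideanSpace ℝ (Fin 2), ‖q‖ = r1 - r2 → ‖p‖ ≤ r1 - r2 →
      coreShellInteraction Γ11 Γ12 Γ22 r1 r2 q ≤ coreShellInteraction Γ11 Γ12 Γ22 r1 r2 p ∧
      (‖p‖ < r1 - r2 →
        coreShellInteraction Γ11 Γ12 Γ22 r1 r2 q < coreShellInteraction Γ11 Γ12 Γ22 r1 r2 p) := by
  intro q p hq hp
  rw [cs_J _ _ _ _ _ hr2 q hq.le, cs_J _ _ _ _ _ hr2 p hp, cs_cross q hq.le, cs_cross p hp]
  have v1 : 0 < volume.real (Metric.ball (0:ℂ) 1) :=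
    ENNReal.toReal_pos (Metric.measure_ball_pos _ _ one_pos).ne' measure_ball_lt_top.ne
  have v2 : 0 < volume.real (Metric.ball (0:EuclideanSpace ℝ (Fin 2)) r2) :=
    ENNReal.toReal_pos (Metric.measure_ball_pos _ _ hr2).ne' measure_ball_lt_top.ne
  have hg : 0 < Γ12 - Γ11 := by linarith
  have hK := mul_pos hg (mul_pos v1 v2)
  constructor
  · have h1 : ‖p‖ ^ 2 ≤ ‖q‖ ^ 2 := pow_le_pow_left₀ (norm_nonneg _) (by linarith) 2
    have := mul_le_mul_of_nonneg_left h1 hK.le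
    linarith
  · intro hlt
    have h1 : ‖p‖ ^ 2 < ‖q‖ ^ 2 := pow_lt_pow_left₀ (by linarith) (norm_nonneg _) (by norm_num)
    have := mul_lt_mul_of_pos_left h1 hK
    linarith
end
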